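/- Let m, n be positive integers with n ≥ 2, m ≥ 4 and 1 < m/n ≤ 2, and assume m − n ≠ 2 unless n = 2. Let ‖·‖₁ be an arbitrary norm on ℝⁿ and ‖·‖₂ an expanding norm on ℝᵐ; if (m,n) = (4,2) assume both ‖·‖₁ and ‖·‖₂ are expanding. Then there exists c_{m,n} = c_{m,n}(‖·‖₁,‖·‖₂) > 0 such that for every c ∈ [0, c_{m,n}]: FS_{m,n}(‖·‖₁,‖·‖₂,c) ≠ ∅; in fact dim_H FS_{m,n}(‖·‖₁,‖·‖₂,c) ≥ m(n−2) + m − 2 if m ≥ 5 and dim_H FS_{m,n}(‖·‖₁,‖·‖₂,c) ≥ m(n−2) if m = 4. In particular the Dirichlet spectrum contains a right neighborhood of 0, and the matrices can be chosen of full ℝ-rank n. -/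

import Mathlib

open Filter MeasureTheory
open scoped ENNReal

/-- `N` is a norm on `ℝ^k` (viewed as `Fin k → ℝ`). -/
def IsNorm {k : ℕ} (N : (Fin k → ℝ) → ℝ) : Prop :=
  (∀ x, N x = 0 ↔ x = 0) ∧ (∀ (c : ℝ) (x : Fin k → ℝ), N (c • x) = |c| * N x) ∧
    ∀ x y, N (x + y) ≤ N x + N y

/-- A norm on `ℝ^k` is expanding if `‖x‖ ≥ ‖π_j(x)‖` for every `x` and every
coordinate projection `π_j`. -/
def IsExpanding {k : ℕ} (N : (Fin k → ℝ) → ℝ) : Prop :=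
  ∀ (x : Fin k → ℝ) (j : Fin k), N (fun i => if i = j then x j else 0) ≤ N x

/-- The best approximation function `ψ_Ω(‖·‖₁,‖·‖₂,t)` of an `m × n` matrix `Ω`. -/
noncomputable def psiGen (m n : ℕ) (N1 : (Fin n → ℝ) → ℝ) (N2 : (Fin m → ℝ) → ℝ)
    (Ω : Fin m → Fin n → ℝ) (t : ℝ) : ℝ :=
  sInf { r : ℝ | ∃ (bh : Fin n → ℤ) (bt : Fin m → ℤ),
    1 ≤ N1 (fun i => (bh i : ℝ)) ∧ N1 (fun i => (bh i : ℝ)) ≤ t ∧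
    r = N2 (fun j => (∑ i, Ω j i * (bh i : ℝ)) + (bt j : ℝ)) }

/-- `Θ(Ω) = limsup_{t→∞} t^{n/m} ψ_Ω(t)`. -/
noncomputable def ThetaGen (m n : ℕ) (N1 : (Fin n → ℝ) → ℝ) (N2 : (Fin m → ℝ) → ℝ)
    (Ω : Fin m → Fin n → ℝ) : ℝ :=
  limsup (fun t : ℝ => t ^ ((n : ℝ) / (m : ℝ)) * psiGen m n N1 N2 Ω t) atTop

/-- `Θ̃(Ω) = liminf_{t→∞} t^{n/m} ψ_Ω(t)`. -/
noncomputable def ThetaTildeGen (m n : ℕ) (N1 : (Fin n → ℝ) → ℝ) (N2 : (Fin m → ℝ) → ℝ)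
    (Ω : Fin m → Fin n → ℝ) : ℝ :=
  liminf (fun t : ℝ => t ^ ((n : ℝ) / (m : ℝ)) * psiGen m n N1 N2 Ω t) atTop

/-- `FS_{m,n}(‖·‖₁,‖·‖₂,c) = DI_{m,n}(‖·‖₁,‖·‖₂,c) \ Bad_{m,n}`. -/
def FSsetC (m n : ℕ) (N1 : (Fin n → ℝ) → ℝ) (N2 : (Fin m → ℝ) → ℝ) (c : ℝ) :
    Set (Fin m → Fin n → ℝ) :=
  {Ω | ThetaGen m n N1 N2 Ω = c} \ {Ω | 0 < ThetaTildeGen m n N1 N2 Ω}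

namespace IsNorm

variable {k : ℕ} {N : (Fin k → ℝ) → ℝ}

lemma apply_zero (hN : IsNorm N) : N 0 = 0 := (hN.1 0).2 rfl

lemma apply_neg (hN : IsNorm N) (x : Fin k → ℝ) : N (-x) = N x := by
  have := hN.2.1 (-1) x
  simpa using this

lemma nonneg (hN : IsNorm N) (x : Fin k → ℝ) : 0 ≤ N x := by
  have h := hN.2.2 x (-x)
  rw [add_neg_cancel, hN.apply_zero, hN.apply_neg] at h
  linarith

lemma apply_single (hN : IsNorm N) (j : Fin k) (a : ℝ) :
    N (Pi.single j a) = |a| * N (Pi.single j 1) := by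
  rw [← hN.2.1, ← Pi.single_smul, smul_eq_mul, mul_one]

lemma apply_single_pos (hN : IsNorm N) (j : Fin k) : 0 < N (Pi.single j 1) := by
  refine lt_of_le_of_ne (hN.nonneg _) fun h => ?_
  have h1 := congrFun ((hN.1 _).1 h.symm) j
  simp at h1

lemma le_sum (hN : IsNorm N) (x : Fin k → ℝ) :
    N x ≤ ∑ j, |x j| * N (Pi.single j 1) := by
  have key : ∀ s : Finset (Fin k), N (∑ j ∈ s, Pi.single j (x j)) ≤
      ∑ j ∈ s, |x j| * N (Pi.single j 1) := by
    intro s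
    induction s using Finset.induction_on with
    | empty => simp [hN.apply_zero]
    | insert a s ha ih =>
      rw [Finset.sum_insert ha, Finset.sum_insert ha]
      refine (hN.2.2 _ _).trans (add_le_add ?_ ih)
      rw [hN.apply_single]
  have h := key Finset.univ
  rwa [Finset.univ_sum_single] at h

lemma continuous (hN : IsNorm N) : Continuous N := by
  rw [continuous_iff_continuousAt]
  intro x
  have hsum : Tendsto (fun y : Fin k → ℝ => ∑ j, |(y - x) j| * N (Pi.single j 1)) (nhds x)
      (nhds 0) := by
    have : Continuous (fun y : Fin k → ℝ => ∑ j, |(y - x) j| * N (Pi.single j 1)) := by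
      simp only [Pi.sub_apply]
      fun_prop
    have h := this.tendsto x
    simpa using h
  rw [ContinuousAt, tendsto_iff_dist_tendsto_zero]
  refine squeeze_zero (fun _ => dist_nonneg) (fun y => ?_) hsum
  refine le_trans ?_ (hN.le_sum (y - x))
  rw [Real.dist_eq, abs_le]
  have h1 := hN.2.2 (y - x) x
  have h2 := hN.2.2 (x - y) y
  rw [sub_add_cancel] at h1 h2
  rw [← neg_sub y x, hN.apply_neg] at h2
  constructor <;> linarith

lemma exists_norm_le (hN : IsNorm N) : ∃ C : ℝ, 0 < C ∧ ∀ x, ‖x‖ ≤ C * N x := by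
  rcases (Metric.sphere (0 : Fin k → ℝ) 1).eq_empty_or_nonempty with h | h
  · refine ⟨1, one_pos, fun x => ?_⟩
    by_cases hx : x = 0
    · simp [hx, hN.apply_zero]
    · exfalso
      have : ‖x‖⁻¹ • x ∈ Metric.sphere (0 : Fin k → ℝ) 1 := by
        simp [norm_smul, norm_ne_zero_iff.2 hx]
      simp [h] at this
  · obtain ⟨y, hy, hmin⟩ := (isCompact_sphere (0 : Fin k → ℝ) 1).exists_isMinOn h
      hN.continuous.continuousOn
    have hy1 : ‖y‖ = 1 := by simpa using hy
    have hy0 : 0 < N y := by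
      refine lt_of_le_of_ne (hN.nonneg _) fun h => ?_
      rw [(hN.1 _).1 h.symm, norm_zero] at hy1
      exact zero_ne_one hy1
    refine ⟨(N y)⁻¹, inv_pos.2 hy0, fun x => ?_⟩
    by_cases hx : x = 0
    · simp [hx, hN.apply_zero]
    · have hpos := norm_pos_iff.2 hx
      have hm : N y ≤ N (‖x‖⁻¹ • x) := hmin (by simp [norm_smul, hpos.ne'])
      rw [hN.2.1, abs_inv, abs_norm] at hm
      rw [← div_eq_inv_mul, le_div_iff₀ hy0]
      rwa [← div_eq_inv_mul, le_div_iff₀ hpos, mul_comm] at hm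

lemma mul_le_of_isExpanding (hN : IsNorm N) (he : IsExpanding N) (x : Fin k → ℝ) (j : Fin k) :
    |x j| * N (Pi.single j 1) ≤ N x := by
  rw [← hN.apply_single]
  convert he x j using 2
  ext i
  simp [Pi.single_apply]

end IsNorm

lemma volume_near_int_le (s δ : ℝ) (b : ℤ) (hb : b ≠ 0) :
    volume {x : ℝ | x ∈ Set.Icc (0 : ℝ) 1 ∧ ∃ z : ℤ, |s + x * b + z| ≤ δ} ≤
      ENNReal.ofReal (6 * δ) := by
  rcases le_total (1 / 2) δ with hδ | hδ
  · calc _ ≤ volume (Set.Icc (0 : ℝ) 1) := measure_mono fun x hx => hx.1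
      _ ≤ ENNReal.ofReal (6 * δ) := by
        rw [Real.volume_Icc]
        exact ENNReal.ofReal_le_ofReal (by linarith)
  rcases lt_or_ge δ 0 with h0 | h0
  · have : {x : ℝ | x ∈ Set.Icc (0 : ℝ) 1 ∧ ∃ z : ℤ, |s + x * b + z| ≤ δ} = ∅ := by
      ext x
      simp only [Set.mem_ofPred_eq, Set.mem_empty_iff_false, iff_false, not_and, not_exists]
      intro _ z hz
      linarith [abs_nonneg (s + x * b + z)]
    rw [this, measure_empty]
    exact zero_le
  have hbR : (1 : ℝ) ≤ |(b : ℝ)| := by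
    rw [← Int.cast_abs]
    exact_mod_cast Int.one_le_abs hb
  have hb0 : (b : ℝ) ≠ 0 := by exact_mod_cast hb
  set lo : ℝ := -δ - s - max (b : ℝ) 0 with hlo
  set hi : ℝ := δ - s - min (b : ℝ) 0 with hhi
  have hwidth : hi - lo = 2 * δ + |(b : ℝ)| := by
    rw [hlo, hhi]
    rcases le_total (b : ℝ) 0 with h | h
    · rw [max_eq_right h, min_eq_left h, abs_of_nonpos h]; ring
    · rw [max_eq_left h, min_eq_right h, abs_of_nonneg h]; ring
  set Z : Finset ℤ := Finset.Icc ⌈lo⌉ ⌊hi⌋ with hZ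
  have hsub : {x : ℝ | x ∈ Set.Icc (0 : ℝ) 1 ∧ ∃ z : ℤ, |s + x * b + z| ≤ δ} ⊆
      ⋃ z ∈ Z, Metric.closedBall (-(s + z) / b) (δ / |(b : ℝ)|) := by
    rintro x ⟨⟨hx0, hx1⟩, z, hz⟩
    simp only [Set.mem_iUnion]
    refine ⟨z, ?_, ?_⟩
    · rw [hZ, Finset.mem_Icc]
      rw [abs_le] at hz
      have h1 : min (b : ℝ) 0 ≤ x * b := by
        rcases le_total (b : ℝ) 0 with h | h
        · rw [min_eq_left h]; nlinarith
        · rw [min_eq_right h]; positivity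
      have h2 : x * b ≤ max (b : ℝ) 0 := by
        rcases le_total (b : ℝ) 0 with h | h
        · rw [max_eq_right h]; nlinarith
        · rw [max_eq_left h]; nlinarith
      exact ⟨Int.ceil_le.2 (by rw [hlo]; linarith [hz.1]),
        Int.le_floor.2 (by rw [hhi]; linarith [hz.2])⟩
    · rw [Metric.mem_closedBall, Real.dist_eq, le_div_iff₀ (by linarith), ← abs_mul]
      have hx : (x - -(s + z) / b) * b = s + x * b + z := by
        rw [sub_mul, div_mul_cancel₀ _ hb0]
        ring
      rwa [hx]
  have hcard : (Z.card : ℝ) ≤ 3 * |(b : ℝ)| := by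
    rw [hZ, Int.card_Icc]
    have h1 : (⌊hi⌋ : ℝ) ≤ hi := Int.floor_le _
    have h2 : lo ≤ (⌈lo⌉ : ℝ) := Int.le_ceil _
    have h3 : (((⌊hi⌋ + 1 - ⌈lo⌉).toNat : ℤ) : ℝ) ≤ 3 * |(b : ℝ)| := by
      rw [Int.toNat_eq_max]
      push_cast
      refine max_le ?_ (by positivity)
      linarith
    exact_mod_cast h3
  calc _ ≤ volume (⋃ z ∈ Z, Metric.closedBall (-(s + z) / b) (δ / |(b : ℝ)|)) :=
        measure_mono hsub
    _ ≤ ∑ z ∈ Z, volume (Metric.closedBall (-(s + z) / b) (δ / |(b : ℝ)|)) :=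
        measure_biUnion_finset_le _ _
    _ = ENNReal.ofReal (Z.card * (2 * (δ / |(b : ℝ)|))) := by
        simp only [Real.volume_closedBall, Finset.sum_const, nsmul_eq_mul]
        rw [ENNReal.ofReal_mul (Nat.cast_nonneg _), ENNReal.ofReal_natCast]
    _ ≤ ENNReal.ofReal (6 * δ) := by
        refine ENNReal.ofReal_le_ofReal ?_
        calc (Z.card : ℝ) * (2 * (δ / |(b : ℝ)|)) ≤ 3 * |(b : ℝ)| * (2 * (δ / |(b : ℝ)|)) := by
              gcongr
          _ = 6 * δ := by field_simp; ring

lemma volume_row_le {p : ℕ} (s δ : ℝ) (b : Fin (p + 1) → ℤ) (hb : b ≠ 0) :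
    volume {x : Fin (p + 1) → ℝ | x ∈ Set.Icc 0 1 ∧ ∃ z : ℤ, |s + ∑ i, x i * b i + z| ≤ δ} ≤
      ENNReal.ofReal (6 * δ) := by
  obtain ⟨i₀, hi₀⟩ : ∃ i, b i ≠ 0 := by
    by_contra! h
    exact hb (funext h)
  set e := MeasurableEquiv.piFinSuccAbove (fun _ : Fin (p + 1) => ℝ) i₀ with he
  have hmp := volume_preserving_piFinSuccAbove (fun _ : Fin (p + 1) => ℝ) i₀
  set A : Set (ℝ × (Fin p → ℝ)) := {q | q.1 ∈ Set.Icc (0 : ℝ) 1 ∧ q.2 ∈ Set.Icc 0 1 ∧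
    ∃ z : ℤ, |(s + ∑ i, q.2 i * b (i₀.succAbove i)) + q.1 * b i₀ + z| ≤ δ} with hA
  have hAm : MeasurableSet A := by
    rw [hA]
    simp only [Set.ofPred_and, Set.ofPred_exists]
    refine MeasurableSet.inter ?_ (MeasurableSet.inter ?_ (MeasurableSet.iUnion fun z => ?_))
    · exact measurable_fst measurableSet_Icc
    · exact measurable_snd measurableSet_Icc
    · exact (isClosed_le (by fun_prop) (by fun_prop)).measurableSet
  have hpre : {x : Fin (p + 1) → ℝ | x ∈ Set.Icc 0 1 ∧
      ∃ z : ℤ, |s + ∑ i, x i * b i + z| ≤ δ} ⊆ e ⁻¹' A := by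
    rintro x ⟨⟨hx0, hx1⟩, z, hz⟩
    refine ⟨⟨hx0 i₀, hx1 i₀⟩, ⟨fun i => hx0 _, fun i => hx1 _⟩, z, ?_⟩
    convert hz using 2
    rw [Fin.sum_univ_succAbove _ i₀]
    simp only [he, MeasurableEquiv.piFinSuccAbove_apply, Fin.insertNthEquiv_symm_apply, Fin.removeNth]
    ring
  calc _ ≤ volume (e ⁻¹' A) := measure_mono hpre
    _ = volume A := hmp.measure_preimage hAm.nullMeasurableSet
    _ = ∫⁻ y, volume ((fun x => (x, y)) ⁻¹' A) := by
        rw [Measure.volume_eq_prod, Measure.prod_apply_symm hAm]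
    _ ≤ ∫⁻ y, (Set.Icc (0 : Fin p → ℝ) 1).indicator (fun _ => ENNReal.ofReal (6 * δ)) y := by
        refine lintegral_mono fun y => ?_
        by_cases hy : y ∈ Set.Icc (0 : Fin p → ℝ) 1
        · rw [Set.indicator_of_mem hy]
          refine le_trans (measure_mono ?_)
            (volume_near_int_le (s + ∑ i, y i * b (i₀.succAbove i)) δ (b i₀) hi₀)
          rintro x ⟨h1, -, h2⟩
          exact ⟨h1, h2⟩
        · rw [Set.indicator_of_notMem hy]
          refine le_of_eq (measure_mono_null (t := ∅) ?_ measure_empty)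
          rintro x ⟨-, h2, -⟩
          exact hy h2
    _ = ENNReal.ofReal (6 * δ) := by
        rw [lintegral_indicator measurableSet_Icc, setLIntegral_const, Real.volume_Icc_pi]
        simp

lemma volume_matrix_le {m p : ℕ} (ξ : Fin m → ℝ) (δ : ℝ) (B : ℕ) :
    volume {X : Fin m → Fin (p + 1) → ℝ | X ∈ Set.Icc 0 1 ∧
      ∃ (b₀ : ℤ) (b : Fin (p + 1) → ℤ), |b₀| ≤ B ∧ (∀ i, |b i| ≤ B) ∧ b ≠ 0 ∧
        ∀ j, ∃ z : ℤ, |ξ j * b₀ + ∑ i, X j i * b i + z| ≤ δ} ≤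
      ENNReal.ofReal ((2 * B + 1) ^ (p + 2)) * ENNReal.ofReal (6 * δ) ^ m := by
  classical
  set I : Finset ℤ := Finset.Icc (-(B : ℤ)) B with hI
  set P : Finset (ℤ × (Fin (p + 1) → ℤ)) :=
    (I ×ˢ Fintype.piFinset fun _ => I).filter fun q => q.2 ≠ 0 with hP
  have hcard : (P.card : ℝ≥0∞) ≤ ENNReal.ofReal ((2 * B + 1) ^ (p + 2)) := by
    have h1 : P.card ≤ (2 * B + 1) ^ (p + 2) := by
      refine (Finset.card_filter_le _ _).trans (le_of_eq ?_)
      have hIc : I.card = 2 * B + 1 := by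
        rw [hI, Int.card_Icc]; omega
      rw [Finset.card_product, Fintype.card_piFinset, Finset.prod_const, hIc, Finset.card_univ,
        Fintype.card_fin]
      ring
    have h2 : ENNReal.ofReal ((2 * B + 1) ^ (p + 2)) = (((2 * B + 1) ^ (p + 2) : ℕ) : ℝ≥0∞) := by
      rw [← ENNReal.ofReal_natCast]
      push_cast
      rfl
    rw [h2]
    exact_mod_cast h1
  calc _ ≤ volume (⋃ q ∈ P, Set.univ.pi fun j : Fin m => {x : Fin (p + 1) → ℝ | x ∈ Set.Icc 0 1 ∧
          ∃ z : ℤ, |ξ j * q.1 + ∑ i, x i * q.2 i + z| ≤ δ}) := by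
        refine measure_mono ?_
        rintro X ⟨⟨hX0, hX1⟩, b₀, b, hb₀, hb, hne, h⟩
        simp only [Set.mem_iUnion]
        refine ⟨(b₀, b), ?_, fun j _ => ⟨⟨hX0 j, hX1 j⟩, h j⟩⟩
        rw [hP, Finset.mem_filter, Finset.mem_product, Fintype.mem_piFinset]
        refine ⟨⟨?_, fun i => ?_⟩, hne⟩
        · rw [hI, Finset.mem_Icc]; exact abs_le.1 hb₀
        · rw [hI, Finset.mem_Icc]; exact abs_le.1 (hb i)
    _ ≤ ∑ q ∈ P, volume (Set.univ.pi fun j : Fin m => {x : Fin (p + 1) → ℝ | x ∈ Set.Icc 0 1 ∧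
          ∃ z : ℤ, |ξ j * q.1 + ∑ i, x i * q.2 i + z| ≤ δ}) := measure_biUnion_finset_le _ _
    _ ≤ ∑ q ∈ P, ENNReal.ofReal (6 * δ) ^ m := by
        refine Finset.sum_le_sum fun q hq => ?_
        rw [volume_pi_pi]
        calc _ ≤ ∏ _j : Fin m, ENNReal.ofReal (6 * δ) :=
              Finset.prod_le_prod' fun j _ => volume_row_le _ _ _ (Finset.mem_filter.1 hq).2
          _ = _ := by simp
    _ = P.card * ENNReal.ofReal (6 * δ) ^ m := by simp
    _ ≤ _ := by gcongr

lemma exists_volume_frequently_ne_zero {α : Type*} [MeasurableSpace α] (μ : Measure α)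
    (K : Set α) (hK : μ K = 1) (B : ℕ → Set α) (k₀ : ℕ) (hB : ∀ k ≥ k₀, μ (B k) ≤ 2⁻¹) :
    μ {x ∈ K | ∃ᶠ k in atTop, x ∉ B k} ≠ 0 := by
  intro h0
  have hmono : Monotone fun N : ℕ => ⋂ k ≥ N + k₀, B k := by
    intro N N' hN
    refine Set.iInter₂_mono' fun k hk => ⟨k, ?_, le_rfl⟩
    simp only [ge_iff_le] at hk ⊢
    omega
  have hU : μ (⋃ N : ℕ, ⋂ k ≥ N + k₀, B k) ≤ 2⁻¹ := by
    rw [hmono.measure_iUnion]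
    exact iSup_le fun N => (measure_mono (Set.iInter₂_subset (N + k₀) le_rfl)).trans
      (hB _ (by omega))
  have hcov : K ⊆ {x ∈ K | ∃ᶠ k in atTop, x ∉ B k} ∪ ⋃ N : ℕ, ⋂ k ≥ N + k₀, B k := by
    intro x hx
    by_cases hf : ∃ᶠ k in atTop, x ∉ B k
    · exact Or.inl ⟨hx, hf⟩
    · right
      simp only [not_frequently, not_not, eventually_atTop] at hf
      obtain ⟨N, hN⟩ := hf
      simp only [Set.mem_iUnion, Set.mem_iInter]
      exact ⟨N, fun k hk => hN k (by omega)⟩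
  have h1 : (1 : ℝ≥0∞) ≤ 2⁻¹ := by
    calc (1 : ℝ≥0∞) = μ K := hK.symm
      _ ≤ _ := measure_mono hcov
      _ ≤ _ := measure_union_le _ _
      _ ≤ 0 + 2⁻¹ := by rw [h0]; gcongr
      _ = 2⁻¹ := zero_add _
  exact absurd h1 (not_le.2 (ENNReal.inv_lt_one.2 (by norm_num)))

lemma natCast_le_dimH_of_volume_ne_zero {m p : ℕ} {s : Set (Fin m → Fin p → ℝ)}
    (hs : volume s ≠ 0) : ((m * p : ℕ) : ℝ≥0∞) ≤ dimH s := by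
  have hfr : Module.finrank ℝ (Fin m → Fin p → ℝ) = m * p := by
    simp [Module.finrank_pi_fintype]
  have hac : (volume : Measure (Fin m → Fin p → ℝ)) ≪
      μH[Module.finrank ℝ (Fin m → Fin p → ℝ)] :=
    Measure.absolutelyContinuous_isAddHaarMeasure _ _
  have hne : μH[Module.finrank ℝ (Fin m → Fin p → ℝ)] s ≠ 0 := fun h => hs (hac h)
  rw [hfr] at hne
  exact_mod_cast le_dimH_of_hausdorffMeasure_ne_zero (d := ((m * p : ℕ) : NNReal))
    (by exact_mod_cast hne)

lemma summable_one_div_of_two_mul_le {u : ℕ → ℕ} (hpos : ∀ k, 0 < u k)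
    (hu : ∀ k, 2 * u k ≤ u (k + 1)) (k : ℕ) :
    ∃ τ : ℝ, 0 ≤ τ ∧ τ ≤ 2 / u k ∧
      ∑' j, (1 : ℝ) / u j = ∑ j ∈ Finset.range k, (1 : ℝ) / u j + τ := by
  have hgrow : ∀ k i, 2 ^ i * u k ≤ u (i + k) := by
    intro k i
    induction i with
    | zero => simp
    | succ i ih =>
      have h := hu (i + k)
      rw [show i + 1 + k = i + k + 1 by ring, pow_succ]
      nlinarith
  have hle : ∀ k i, (1 : ℝ) / u (i + k) ≤ (1 / 2) ^ i * (1 / u k) := by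
    intro k i
    have h1 : ((2 : ℝ) ^ i * u k) ≤ u (i + k) := by exact_mod_cast hgrow k i
    have h2 : (0 : ℝ) < u k := by exact_mod_cast hpos k
    calc (1 : ℝ) / u (i + k) ≤ 1 / (2 ^ i * u k) := by gcongr
      _ = _ := by rw [div_pow, one_pow]; field_simp
  have hsg : ∀ k, Summable fun i : ℕ => ((1 : ℝ) / 2) ^ i * (1 / u k) := fun k =>
    summable_geometric_two.mul_right _
  have hs : ∀ k, Summable fun i : ℕ => (1 : ℝ) / u (i + k) := fun k =>
    Summable.of_nonneg_of_le (fun i => by positivity) (hle k) (hsg k)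
  refine ⟨∑' i, (1 : ℝ) / u (i + k), tsum_nonneg fun i => by positivity, ?_, ?_⟩
  · calc _ ≤ ∑' i : ℕ, ((1 : ℝ) / 2) ^ i * (1 / u k) := (hs k).tsum_le_tsum (hle k) (hsg k)
      _ = 2 / u k := by rw [tsum_mul_right, tsum_geometric_two]; ring
  · exact ((hs 0).sum_add_tsum_nat_add k).symm

lemma exists_int_eq_mul_sum {u : ℕ → ℕ} (hpos : ∀ k, 0 < u k) (q k : ℕ)
    (hd : ∀ j < k, u j ∣ q) :
    ∃ z : ℤ, (q : ℝ) * ∑ j ∈ Finset.range k, (1 : ℝ) / u j = z := by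
  refine ⟨∑ j ∈ Finset.range k, ((q / u j : ℕ) : ℤ), ?_⟩
  rw [Finset.mul_sum, Int.cast_sum]
  refine Finset.sum_congr rfl fun j hj => ?_
  obtain ⟨r, hr⟩ := hd j (Finset.mem_range.1 hj)
  have h := hpos j
  rw [hr, Nat.mul_div_cancel_left _ h, Int.cast_natCast]
  have : (u j : ℝ) ≠ 0 := by exact_mod_cast h.ne'
  push_cast
  field_simp

/-- Denominators of the rational approximations to the special column. -/
def denomSeq (m : ℕ) (M : ℕ → ℕ) : ℕ → ℕ
  | 0 => 2
  | k + 1 => denomSeq m M k ^ (2 * m) * M (denomSeq m M k ^ (2 * m))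

section DenomSeq

variable {m : ℕ} {M : ℕ → ℕ}

lemma two_le_denomSeq (hm : 2 ≤ m) (hM : ∀ s, 1 ≤ M s) (k : ℕ) : 2 ≤ denomSeq m M k := by
  induction k with
  | zero => exact le_rfl
  | succ k ih =>
    rw [denomSeq]
    calc 2 ≤ denomSeq m M k := ih
      _ ≤ denomSeq m M k ^ (2 * m) := Nat.le_self_pow (by omega) _
      _ ≤ _ := Nat.le_mul_of_pos_right _ (hM _)

lemma two_mul_denomSeq_le_pow (hm : 2 ≤ m) (hM : ∀ s, 1 ≤ M s) (k : ℕ) :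
    2 * denomSeq m M k ≤ denomSeq m M k ^ (2 * m) := by
  have h := two_le_denomSeq hm hM k
  calc 2 * denomSeq m M k ≤ denomSeq m M k ^ 2 := by nlinarith
    _ ≤ _ := Nat.pow_le_pow_right (by omega) (by omega)

lemma denomSeq_pow_dvd (m : ℕ) (M : ℕ → ℕ) (k : ℕ) :
    denomSeq m M k ^ (2 * m) ∣ denomSeq m M (k + 1) := Dvd.intro _ rfl

lemma denomSeq_pow_le (hm : 2 ≤ m) (hM : ∀ s, 1 ≤ M s) (k : ℕ) :
    denomSeq m M k ^ (2 * m) ≤ denomSeq m M (k + 1) :=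
  Nat.le_of_dvd (by have := two_le_denomSeq hm hM (k + 1); omega) (denomSeq_pow_dvd m M k)

lemma two_mul_denomSeq_le (hm : 2 ≤ m) (hM : ∀ s, 1 ≤ M s) (k : ℕ) :
    2 * denomSeq m M k ≤ denomSeq m M (k + 1) :=
  (two_mul_denomSeq_le_pow hm hM k).trans (denomSeq_pow_le hm hM k)

lemma lt_denomSeq (hm : 2 ≤ m) (hM : ∀ s, 1 ≤ M s) (k : ℕ) : k < denomSeq m M k := by
  induction k with
  | zero => exact Nat.two_pos
  | succ k ih =>
    have := two_mul_denomSeq_le hm hM k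
    omega

lemma two_mul_denomSeq_pow_le (hm : 2 ≤ m) (hM : ∀ s, 1 ≤ M s) (k : ℕ) :
    2 * denomSeq m M k ^ (2 * m) ≤ denomSeq m M (k + 1) ^ (2 * m) :=
  (Nat.mul_le_mul_left 2 (denomSeq_pow_le hm hM k)).trans (two_mul_denomSeq_le_pow hm hM _)

lemma denomSeq_dvd_denomSeq (hm : 2 ≤ m) {j k : ℕ} (hjk : j ≤ k) :
    denomSeq m M j ∣ denomSeq m M k := by
  induction k, hjk using Nat.le_induction with
  | base => exact dvd_rfl
  | succ k _ ih =>
    exact ih.trans ((dvd_pow_self _ (by omega)).trans (denomSeq_pow_dvd m M k))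

lemma denomSeq_pow_dvd_denomSeq (hm : 2 ≤ m) {j k : ℕ} (hjk : j < k) :
    denomSeq m M j ^ (2 * m) ∣ denomSeq m M k :=
  (denomSeq_pow_dvd m M j).trans (denomSeq_dvd_denomSeq hm hjk)

lemma exists_column_approx (hm : 2 ≤ m) (hM : ∀ s, 1 ≤ M s) :
    ∃ x y : ℝ, ∀ k,
      (∃ z₁ z₂ : ℤ,
        |denomSeq m M k * x + z₁| ≤ 2 * denomSeq m M k / (denomSeq m M k : ℝ) ^ (2 * m) ∧
        |denomSeq m M k * y + z₂| ≤ 2 * denomSeq m M k / (denomSeq m M k : ℝ) ^ (2 * m)) ∧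
      (∃ z₁ z₂ : ℤ,
        |(denomSeq m M k : ℝ) ^ (2 * m) * x + z₁| ≤
          1 / M (denomSeq m M k ^ (2 * m)) + 2 / (denomSeq m M (k + 1) : ℝ) ^ 3 ∧
        |(denomSeq m M k : ℝ) ^ (2 * m) * y + z₂| ≤ 2 / (denomSeq m M (k + 1) : ℝ) ^ 3) ∧
      ∀ q : ℤ, q ≠ 0 → |q| < denomSeq m M (k + 1) → ∀ z₁ z₂ : ℤ,
        1 / (denomSeq m M k : ℝ) ^ (2 * m) - 2 / (denomSeq m M (k + 1) : ℝ) ^ 3 ≤ |q * y + z₂| ∨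
        1 / (M (denomSeq m M k ^ (2 * m)) : ℝ) - 2 / (denomSeq m M (k + 1) : ℝ) ^ 3 ≤
          |q * x + z₁| := by
  set Q := denomSeq m M with hQ
  have hQ2 : ∀ k, 2 ≤ Q k := two_le_denomSeq hm hM
  have hQpos : ∀ k, 0 < Q k := fun k => by have := hQ2 k; omega
  have hSpos : ∀ k, 0 < Q k ^ (2 * m) := fun k => Nat.pow_pos (hQpos k)
  have tailQ := summable_one_div_of_two_mul_le hQpos (two_mul_denomSeq_le hm hM)
  have tailS := summable_one_div_of_two_mul_le (u := fun k => Q k ^ (2 * m)) hSpos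
    (two_mul_denomSeq_pow_le hm hM)
  refine ⟨∑' j, (1 : ℝ) / Q j, ∑' j, (1 : ℝ) / (Q j ^ (2 * m) : ℕ), fun k => ?_⟩
  have hMk := hM (Q k ^ (2 * m))
  have hTS : Q (k + 1) = Q k ^ (2 * m) * M (Q k ^ (2 * m)) := by rw [hQ, denomSeq]
  set μ := M (Q k ^ (2 * m)) with hμ
  have hμR : (0 : ℝ) < μ := by exact_mod_cast hMk
  have hqR : (0 : ℝ) < Q k := by exact_mod_cast hQpos k
  have hTR : (0 : ℝ) < Q (k + 1) := by exact_mod_cast hQpos (k + 1)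
  have hSR : (0 : ℝ) < (Q k : ℝ) ^ (2 * m) := by positivity
  have hTSR : (Q (k + 1) : ℝ) = (Q k : ℝ) ^ (2 * m) * μ := by exact_mod_cast hTS
  have hST : (Q k : ℝ) ^ (2 * m) ≤ Q (k + 1) := by exact_mod_cast denomSeq_pow_le hm hM k
  have hS1 : (Q (k + 1) : ℝ) ^ 4 ≤ (Q (k + 1) : ℝ) ^ (2 * m) :=
    pow_le_pow_right₀ (by exact_mod_cast hQpos (k + 1)) (by omega)
  have hQ2S : (Q (k + 1) : ℝ) ^ (2 * m) ≤ Q (k + 2) := by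
    exact_mod_cast denomSeq_pow_le hm hM (k + 1)
  have herr : ∀ q τ U : ℝ, |q| ≤ Q (k + 1) → 0 ≤ τ → τ ≤ 2 / U →
      (Q (k + 1) : ℝ) ^ 4 ≤ U → |q * τ| ≤ 2 / (Q (k + 1) : ℝ) ^ 3 := by
    intro q τ U hq hτ0 hτ hU
    rw [abs_mul, abs_of_nonneg hτ0]
    calc |q| * τ ≤ Q (k + 1) * (2 / (Q (k + 1) : ℝ) ^ 4) := by
          gcongr
          exact hτ.trans (by gcongr)
      _ = _ := by field_simp
  obtain ⟨τ₁, hτ₁0, hτ₁, hx₁⟩ := tailQ (k + 1)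
  obtain ⟨τ₂, hτ₂0, hτ₂, hx₂⟩ := tailQ (k + 2)
  obtain ⟨σ₀, hσ₀0, hσ₀, hy₀⟩ := tailS k
  obtain ⟨σ₁, hσ₁0, hσ₁, hy₁⟩ := tailS (k + 1)
  push_cast at hσ₀ hσ₁
  obtain ⟨w₁, hw₁⟩ := exists_int_eq_mul_sum hQpos (Q k) (k + 1)
    fun j hj => denomSeq_dvd_denomSeq hm (by omega)
  obtain ⟨w₂, hw₂⟩ := exists_int_eq_mul_sum hSpos (Q k) k
    fun j hj => denomSeq_pow_dvd_denomSeq hm hj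
  obtain ⟨w₃, hw₃⟩ := exists_int_eq_mul_sum hQpos (Q k ^ (2 * m)) (k + 1)
    fun j hj => (denomSeq_dvd_denomSeq hm (by omega)).trans (dvd_pow_self (Q k) (by omega))
  have hy₁' : ∑' j, (1 : ℝ) / (Q j ^ (2 * m) : ℕ) =
      ∑ j ∈ Finset.range k, (1 : ℝ) / (Q j ^ (2 * m) : ℕ) + 1 / (Q k : ℝ) ^ (2 * m) + σ₁ := by
    rw [hy₁, Finset.sum_range_succ]; push_cast; ring
  have hx₂' : ∑' j, (1 : ℝ) / (Q j : ℕ) =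
      ∑ j ∈ Finset.range (k + 1), (1 : ℝ) / Q j + 1 / Q (k + 1) + τ₂ := by
    rw [hx₂, Finset.sum_range_succ]
  push_cast at hw₃
  refine ⟨⟨-w₁, -w₂, ?_, ?_⟩, ⟨-w₃, -(w₂ * (Q k : ℤ) ^ (2 * m - 1) + 1), ?_, ?_⟩, ?_⟩
  · rw [hx₁, mul_add, hw₁]
    push_cast
    rw [show (w₁ : ℝ) + Q k * τ₁ + -w₁ = Q k * τ₁ by ring, abs_of_nonneg (by positivity),
      mul_comm (2 : ℝ), mul_div_assoc]
    gcongr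
    exact hτ₁.trans (by gcongr)
  · rw [hy₀, mul_add, hw₂]
    push_cast
    rw [show (w₂ : ℝ) + Q k * σ₀ + -w₂ = Q k * σ₀ by ring, abs_of_nonneg (by positivity),
      mul_comm (2 : ℝ), mul_div_assoc]
    gcongr
  · rw [hx₂', mul_add, mul_add, hw₃]
    push_cast
    rw [show (w₃ : ℝ) + (Q k : ℝ) ^ (2 * m) * (1 / Q (k + 1)) + (Q k : ℝ) ^ (2 * m) * τ₂ + -w₃ =
      (Q k : ℝ) ^ (2 * m) * (1 / Q (k + 1)) + (Q k : ℝ) ^ (2 * m) * τ₂ by ring]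
    have h1 : (Q k : ℝ) ^ (2 * m) * (1 / Q (k + 1)) = 1 / μ := by rw [hTSR]; field_simp
    rw [h1]
    refine (abs_add_le _ _).trans (add_le_add (le_of_eq (abs_of_pos (by positivity))) ?_)
    exact herr _ _ _ (by rwa [abs_of_pos hSR]) hτ₂0 hτ₂ (hS1.trans hQ2S)
  · have hpow : (Q k : ℝ) ^ (2 * m) = (Q k : ℝ) ^ (2 * m - 1) * Q k := by
      rw [← pow_succ]; congr 1; omega
    have h1 : (Q k : ℝ) ^ (2 * m) * ∑' j, (1 : ℝ) / (Q j ^ (2 * m) : ℕ) =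
        (Q k : ℝ) ^ (2 * m - 1) * w₂ + 1 + (Q k : ℝ) ^ (2 * m) * σ₁ := by
      rw [hy₁', mul_add, mul_add, ← hw₂, mul_one_div_cancel hSR.ne', hpow]
      ring
    rw [h1]
    push_cast
    rw [show (Q k : ℝ) ^ (2 * m - 1) * w₂ + 1 + (Q k : ℝ) ^ (2 * m) * σ₁ +
      -(w₂ * (Q k : ℝ) ^ (2 * m - 1) + 1) = (Q k : ℝ) ^ (2 * m) * σ₁ by ring]
    exact herr _ _ _ (by rwa [abs_of_pos hSR]) hσ₁0 hσ₁ hS1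
  · intro q hq0 hqT z₁ z₂
    have hqTR : |(q : ℝ)| ≤ Q (k + 1) := by
      rw [← Int.cast_abs]; exact_mod_cast hqT.le
    have hpow : (Q k : ℝ) ^ (2 * m) = Q k * (Q k : ℝ) ^ (2 * m - 1) := by
      rw [← pow_succ']; congr 1; omega
    set a : ℤ := 1 + Q k * ((Q k : ℤ) ^ (2 * m - 2) * w₂) with ha
    have haR : (a : ℝ) = (Q k : ℝ) ^ (2 * m - 1) * w₂ + 1 := by
      rw [ha]; push_cast
      rw [show 2 * m - 1 = (2 * m - 2) + 1 by omega, pow_succ]; ring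
    have hyq : q * ∑' j, (1 : ℝ) / (Q j ^ (2 * m) : ℕ) + z₂ =
        ((q * a + z₂ * (Q k : ℤ) ^ (2 * m) : ℤ) : ℝ) / (Q k : ℝ) ^ (2 * m) + q * σ₁ := by
      rw [hy₁']
      push_cast
      rw [haR, ← hw₂, hpow]
      field_simp
      push_cast
      ring
    by_cases hN : q * a + z₂ * (Q k : ℤ) ^ (2 * m) = 0
    · right
      have hcop : IsCoprime ((Q k : ℤ) ^ (2 * m)) a := by
        refine IsCoprime.pow_left (IsCoprime.symm ?_)
        rw [ha]
        exact isCoprime_one_left.add_mul_left_left _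
      have hdvd : (Q k : ℤ) ^ (2 * m) ∣ q :=
        hcop.dvd_of_dvd_mul_right ⟨-z₂, by linear_combination hN⟩
      obtain ⟨j, rfl⟩ := hdvd
      have hxq : (((Q k : ℤ) ^ (2 * m) * j : ℤ) : ℝ) * ∑' j, (1 : ℝ) / (Q j : ℕ) + z₁ =
          ((j + μ * (w₃ * j + z₁) : ℤ) : ℝ) / μ + (((Q k : ℤ) ^ (2 * m) * j : ℤ) : ℝ) * τ₂ := by
        rw [hx₂', hTSR]
        push_cast
        rw [← hw₃]
        field_simp
        ring
      have hN' : j + μ * (w₃ * j + z₁) ≠ 0 := by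
        intro h0
        have hd : (Q (k + 1) : ℤ) ∣ (Q k : ℤ) ^ (2 * m) * j := by
          rw [hTS]
          push_cast
          exact mul_dvd_mul_left _ ⟨-(w₃ * j + z₁), by linear_combination h0⟩
        exact hq0 (Int.eq_zero_of_abs_lt_dvd hd hqT)
      have h1 : 1 / (μ : ℝ) ≤ |((j + μ * (w₃ * j + z₁) : ℤ) : ℝ) / μ| := by
        rw [abs_div, abs_of_pos hμR]
        gcongr
        rw [← Int.cast_abs]
        exact_mod_cast Int.one_le_abs hN'
      have h2 := herr _ _ _ hqTR hτ₂0 hτ₂ (hS1.trans hQ2S)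
      rw [hxq]
      have h3 := abs_sub_abs_le_abs_add (((j + μ * (w₃ * j + z₁) : ℤ) : ℝ) / μ)
        ((((Q k : ℤ) ^ (2 * m) * j : ℤ) : ℝ) * τ₂)
      linarith
    · left
      have h1 : 1 / (Q k : ℝ) ^ (2 * m) ≤
          |((q * a + z₂ * (Q k : ℤ) ^ (2 * m) : ℤ) : ℝ) / (Q k : ℝ) ^ (2 * m)| := by
        rw [abs_div, abs_of_pos hSR]
        gcongr
        rw [← Int.cast_abs]
        exact_mod_cast Int.one_le_abs hN
      have h2 := herr _ _ _ hqTR hσ₁0 hσ₁ hS1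
      rw [hyq]
      have h3 := abs_sub_abs_le_abs_add
        (((q * a + z₂ * (Q k : ℤ) ^ (2 * m) : ℤ) : ℝ) / (Q k : ℝ) ^ (2 * m)) (q * σ₁)
      linarith

end DenomSeq

lemma exists_critical_multiplier {w β c K : ℝ} (hw : 1 / 2 ≤ w) (hw1 : w < 1) (hβ : 0 < β)
    (hc : 0 < c) (hK : 0 < K) (hcK : c < β / K ^ w) {s : ℕ} (hs : 1 ≤ s) :
    ∃ M : ℕ, 1 ≤ M ∧ β * ((s : ℝ) * M) ^ w ≤ c * M ∧ c * (M - 1) ≤ β * ((s : ℝ) * M) ^ w ∧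
      K * s ≤ M := by
  classical
  have hsR : (0 : ℝ) < s := by exact_mod_cast hs
  have hex : ∃ M : ℕ, 1 ≤ M ∧ β * ((s : ℝ) * M) ^ w ≤ c * M := by
    have ht : Tendsto (fun x : ℝ => β * (s : ℝ) ^ w * x ^ (-(1 - w))) atTop
        (nhds (β * (s : ℝ) ^ w * 0)) :=
      (tendsto_rpow_neg_atTop (by linarith)).const_mul _
    rw [mul_zero] at ht
    have hev := (ht.comp (tendsto_natCast_atTop_atTop (R := ℝ))).eventually
      (eventually_le_nhds hc)
    obtain ⟨M, hM, hM1⟩ := (hev.and (eventually_ge_atTop 1)).exists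
    refine ⟨M, hM1, ?_⟩
    have hMR : (0 : ℝ) < M := by exact_mod_cast hM1
    simp only [Function.comp] at hM
    calc β * ((s : ℝ) * M) ^ w = β * (s : ℝ) ^ w * (M : ℝ) ^ (-(1 - w)) * M := by
          rw [Real.mul_rpow hsR.le hMR.le, mul_assoc _ _ (M : ℝ),
            ← Real.rpow_add_one hMR.ne']
          ring_nf
      _ ≤ c * M := by gcongr
  obtain ⟨M, ⟨hM1, hM2⟩, hmin⟩ : ∃ M : ℕ, (1 ≤ M ∧ β * ((s : ℝ) * M) ^ w ≤ c * M) ∧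
      ∀ M' < M, ¬ (1 ≤ M' ∧ β * ((s : ℝ) * M') ^ w ≤ c * M') :=
    ⟨Nat.find hex, Nat.find_spec hex, fun _ => Nat.find_min hex⟩
  have hMR : (0 : ℝ) < M := by exact_mod_cast hM1
  refine ⟨M, hM1, hM2, ?_, ?_⟩
  · rcases hM1.eq_or_lt with h | h
    · rw [← h]
      simp only [Nat.cast_one, sub_self, mul_zero]
      positivity
    · have h1 := hmin (M - 1) (by omega)
      rw [not_and, not_le] at h1
      replace h1 := h1 (by omega)
      rw [Nat.cast_sub hM1, Nat.cast_one] at h1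
      refine h1.le.trans ?_
      have hM1R : (1 : ℝ) ≤ M := by exact_mod_cast hM1
      gcongr
      linarith
  · by_contra! hlt
    have h1 : (M : ℝ) / K ^ w ≤ ((s : ℝ) * M) ^ w := by
      calc (M : ℝ) / K ^ w ≤ ((M : ℝ) ^ 2) ^ w / K ^ w := by
            gcongr
            rw [← Real.rpow_natCast, ← Real.rpow_mul hMR.le]
            refine Real.self_le_rpow_of_one_le (by exact_mod_cast hM1) ?_
            push_cast
            linarith
        _ = ((M : ℝ) ^ 2 / K) ^ w := by rw [Real.div_rpow (by positivity) hK.le]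
        _ ≤ _ := by
            gcongr
            rw [div_le_iff₀ hK]
            nlinarith
    have h2 : β * (M / K ^ w) ≤ c * M := le_trans (by gcongr) hM2
    have h3 : c * M < β / K ^ w * M := by gcongr
    have h4 : β * (M / K ^ w) = β / K ^ w * M := by ring
    linarith

section Psi

variable {m n : ℕ} {N1 : (Fin n → ℝ) → ℝ} {N2 : (Fin m → ℝ) → ℝ}

lemma psiGen_nonneg (hN2 : IsNorm N2) (Ω : Fin m → Fin n → ℝ) (t : ℝ) :
    0 ≤ psiGen m n N1 N2 Ω t := by
  refine Real.sInf_nonneg ?_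
  rintro r ⟨bh, bt, -, -, rfl⟩
  exact hN2.nonneg _

lemma psiGen_le (hN2 : IsNorm N2) (Ω : Fin m → Fin n → ℝ) (t : ℝ) (bh : Fin n → ℤ)
    (bt : Fin m → ℤ) (h1 : 1 ≤ N1 (fun i => (bh i : ℝ))) (h2 : N1 (fun i => (bh i : ℝ)) ≤ t) :
    psiGen m n N1 N2 Ω t ≤ N2 (fun j => (∑ i, Ω j i * (bh i : ℝ)) + (bt j : ℝ)) := by
  refine csInf_le ⟨0, ?_⟩ ⟨bh, bt, h1, h2, rfl⟩
  rintro r ⟨bh, bt, -, -, rfl⟩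
  exact hN2.nonneg _

lemma psiGen_add_int (Ω : Fin m → Fin n → ℝ) (Z : Fin m → Fin n → ℤ) (t : ℝ) :
    psiGen m n N1 N2 (fun j i => Ω j i + Z j i) t = psiGen m n N1 N2 Ω t := by
  unfold psiGen
  congr 1
  ext r
  constructor
  · rintro ⟨bh, bt, h1, h2, rfl⟩
    refine ⟨bh, fun j => (∑ i, Z j i * bh i) + bt j, h1, h2, ?_⟩
    congr 1
    ext j
    push_cast
    simp only [add_mul, Finset.sum_add_distrib]
    ring
  · rintro ⟨bh, bt, h1, h2, rfl⟩
    refine ⟨bh, fun j => bt j - ∑ i, Z j i * bh i, h1, h2, ?_⟩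
    congr 1
    ext j
    push_cast
    simp only [add_mul, Finset.sum_add_distrib]
    ring

lemma add_int_mem_FSsetC {c : ℝ} {Ω : Fin m → Fin n → ℝ} (hΩ : Ω ∈ FSsetC m n N1 N2 c)
    (Z : Fin m → Fin n → ℤ) : (fun j i => Ω j i + Z j i) ∈ FSsetC m n N1 N2 c := by
  simpa only [FSsetC, Set.mem_sdiff, Set.mem_ofPred_eq, ThetaGen, ThetaTildeGen, psiGen_add_int]
    using hΩ

lemma exists_mem_FSsetC_rank_eq (hnm : n ≤ m) {c : ℝ} {Ω : Fin m → Fin n → ℝ}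
    (hΩ : Ω ∈ FSsetC m n N1 N2 c) :
    ∃ Ω' ∈ FSsetC m n N1 N2 c, (Matrix.of Ω').rank = n := by
  set A : Matrix (Fin n) (Fin n) ℝ := Matrix.of fun i k => Ω (Fin.castLE hnm i) k with hA
  obtain ⟨k, hk⟩ : ∃ k : ℕ, ¬ (Matrix.charpoly (-A)).IsRoot (k : ℝ) := by
    by_contra! h
    refine (Matrix.charpoly_monic (-A)).ne_zero
      (Polynomial.eq_zero_of_infinite_isRoot _ ?_)
    exact (Set.infinite_range_of_injective (Nat.cast_injective (R := ℝ))).mono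
      (by rintro _ ⟨k, rfl⟩; exact h k)
  rw [Polynomial.IsRoot, Matrix.eval_charpoly, sub_neg_eq_add] at hk
  set Z : Fin m → Fin n → ℤ := fun j i => if j = Fin.castLE hnm i then (k : ℤ) else 0 with hZ
  refine ⟨_, add_int_mem_FSsetC hΩ Z, le_antisymm ?_ ?_⟩
  · simpa using Matrix.rank_le_width (Matrix.of fun j i => Ω j i + Z j i)
  · have hsub : (Matrix.of fun j i => Ω j i + (Z j i : ℝ)).submatrix (Fin.castLE hnm) id =
        Matrix.scalar (Fin n) (k : ℝ) + A := by
      ext i i'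
      simp only [Matrix.submatrix_apply, id, Matrix.of_apply, hZ, Matrix.add_apply,
        Matrix.scalar_apply, Matrix.diagonal_apply, hA, (Fin.castLE_injective hnm).eq_iff]
      split_ifs <;> push_cast <;> ring
    have hr := Matrix.rank_of_isUnit (Matrix.scalar (Fin n) (k : ℝ) + A)
      ((Matrix.isUnit_iff_isUnit_det _).2 (isUnit_iff_ne_zero.2 hk))
    rw [Fintype.card_fin, ← hsub] at hr
    calc n = _ := hr.symm
      _ ≤ _ := Matrix.rank_submatrix_le _ _ _

lemma mem_FSsetC_of_bounds (hN2 : IsNorm N2) {c : ℝ} {Ω : Fin m → Fin n → ℝ}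
    (hub : ∀ δ > 0, ∀ᶠ t : ℝ in atTop,
      t ^ ((n : ℝ) / (m : ℝ)) * psiGen m n N1 N2 Ω t ≤ c + δ)
    (hlb : ∀ δ > 0, ∃ᶠ t : ℝ in atTop,
      c - δ ≤ t ^ ((n : ℝ) / (m : ℝ)) * psiGen m n N1 N2 Ω t)
    (hzero : ∀ δ > 0, ∃ᶠ t : ℝ in atTop,
      t ^ ((n : ℝ) / (m : ℝ)) * psiGen m n N1 N2 Ω t ≤ δ) :
    Ω ∈ FSsetC m n N1 N2 c := by
  have hnn : ∀ᶠ t : ℝ in atTop, 0 ≤ t ^ ((n : ℝ) / (m : ℝ)) * psiGen m n N1 N2 Ω t := by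
    filter_upwards [eventually_ge_atTop 0] with t ht
    exact mul_nonneg (Real.rpow_nonneg ht _) (psiGen_nonneg hN2 _ _)
  have hbdd : IsBoundedUnder (· ≤ ·) atTop
      (fun t : ℝ => t ^ ((n : ℝ) / (m : ℝ)) * psiGen m n N1 N2 Ω t) :=
    ⟨c + 1, eventually_map.2 (hub 1 one_pos)⟩
  have hbddb : IsBoundedUnder (· ≥ ·) atTop
      (fun t : ℝ => t ^ ((n : ℝ) / (m : ℝ)) * psiGen m n N1 N2 Ω t) :=
    ⟨0, eventually_map.2 hnn⟩
  refine ⟨le_antisymm ?_ ?_, ?_⟩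
  · exact le_of_forall_pos_le_add fun δ hδ => limsup_le_of_le hbddb.isCoboundedUnder_le (hub δ hδ)
  · refine le_of_forall_sub_le fun δ hδ => ?_
    exact le_limsup_of_frequently_le (hlb δ hδ) hbdd
  · simp only [Set.mem_ofPred_eq, not_lt]
    refine le_of_forall_pos_le_add fun δ hδ => ?_
    rw [zero_add]
    exact liminf_le_of_frequently_le (hzero δ hδ) hbddb

end Psi

/-- The matrix with first column `ξ` and remaining columns `X`. -/
def consColumn {m p : ℕ} (ξ : Fin m → ℝ) (X : Fin m → Fin (p + 1) → ℝ) :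
    Fin m → Fin (p + 2) → ℝ :=
  fun j => Fin.cons (ξ j) (X j)

section Column

variable {m p : ℕ} {N1 : (Fin (p + 2) → ℝ) → ℝ} {N2 : (Fin m → ℝ) → ℝ}

lemma sum_consColumn_mul (ξ : Fin m → ℝ) (X : Fin m → Fin (p + 1) → ℝ) (b : Fin (p + 2) → ℤ)
    (j : Fin m) :
    ∑ i, consColumn ξ X j i * (b i : ℝ) = ξ j * b 0 + ∑ i, X j i * b (Fin.succ i) := by
  rw [Fin.sum_univ_succ]
  simp [consColumn]

lemma psiGen_consColumn_le (hN1 : IsNorm N1) (hN2 : IsNorm N2) (ξ : Fin m → ℝ)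
    (X : Fin m → Fin (p + 1) → ℝ) (t : ℝ) (q : ℤ) (z : Fin m → ℤ)
    (h1 : 1 ≤ |(q : ℝ)| * N1 (Pi.single 0 1)) (h2 : |(q : ℝ)| * N1 (Pi.single 0 1) ≤ t) :
    psiGen m (p + 2) N1 N2 (consColumn ξ X) t ≤ N2 (fun j => q * ξ j + z j) := by
  have hb : (fun i => ((Pi.single 0 q : Fin (p + 2) → ℤ) i : ℝ)) = Pi.single 0 (q : ℝ) := by
    ext i
    simp only [Pi.single_apply]
    split_ifs <;> simp
  have h := psiGen_le (N1 := N1) hN2 (consColumn ξ X) t (Pi.single 0 q) z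
    (by rwa [hb, hN1.apply_single]) (by rwa [hb, hN1.apply_single])
  refine h.trans (le_of_eq ?_)
  congr 1
  ext j
  rw [sum_consColumn_mul]
  simp [mul_comm]

lemma psiGen_pair_le (hN1 : IsNorm N1) (hN2 : IsNorm N2) {i₀ i₁ : Fin m}
    (x y : ℝ) (X : Fin m → Fin (p + 1) → ℝ) (t : ℝ) (q z₁ z₂ : ℤ)
    (h1 : 1 ≤ |(q : ℝ)| * N1 (Pi.single 0 1)) (h2 : |(q : ℝ)| * N1 (Pi.single 0 1) ≤ t) :
    psiGen m (p + 2) N1 N2 (consColumn (Pi.single i₀ x + Pi.single i₁ y) X) t ≤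
      |q * x + z₁| * N2 (Pi.single i₀ 1) + |q * y + z₂| * N2 (Pi.single i₁ 1) := by
  refine (psiGen_consColumn_le hN1 hN2 _ X t q (Pi.single i₀ z₁ + Pi.single i₁ z₂) h1 h2).trans ?_
  have : (fun j => q * (Pi.single i₀ x + Pi.single i₁ y : Fin m → ℝ) j +
      ((Pi.single i₀ z₁ + Pi.single i₁ z₂ : Fin m → ℤ) j : ℝ)) =
      Pi.single i₀ (q * x + z₁) + Pi.single i₁ (q * y + z₂) := by
    ext j
    simp only [Pi.add_apply, Pi.single_apply]
    split_ifs <;> push_cast <;> ring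
  rw [this]
  refine (hN2.2.2 _ _).trans (le_of_eq ?_)
  rw [hN2.apply_single, hN2.apply_single i₁]

lemma le_psiGen_consColumn (hN1 : IsNorm N1) {ξ : Fin m → ℝ} {X : Fin m → Fin (p + 1) → ℝ}
    {t r : ℝ} (q₀ : ℤ) (h1 : 1 ≤ |(q₀ : ℝ)| * N1 (Pi.single 0 1))
    (h2 : |(q₀ : ℝ)| * N1 (Pi.single 0 1) ≤ t)
    (hcol : ∀ q : ℤ, q ≠ 0 → |(q : ℝ)| * N1 (Pi.single 0 1) ≤ t → ∀ z : Fin m → ℤ,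
      r ≤ N2 (fun j => q * ξ j + z j))
    (hrest : ∀ b : Fin (p + 2) → ℤ, Fin.tail b ≠ 0 → N1 (fun i => (b i : ℝ)) ≤ t →
      ∀ z : Fin m → ℤ, r ≤ N2 (fun j => ξ j * b 0 + ∑ i, X j i * Fin.tail b i + z j)) :
    r ≤ psiGen m (p + 2) N1 N2 (consColumn ξ X) t := by
  have hb : ∀ q : ℤ, (fun i => ((Pi.single 0 q : Fin (p + 2) → ℤ) i : ℝ)) =
      Pi.single 0 (q : ℝ) := by
    intro q
    ext i
    simp only [Pi.single_apply]
    split_ifs <;> simp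
  refine le_csInf ⟨_, Pi.single 0 q₀, 0, ?_, ?_, rfl⟩ ?_
  · rwa [hb, hN1.apply_single]
  · rwa [hb, hN1.apply_single]
  rintro _ ⟨b, z, hb1, hbt, rfl⟩
  simp only [sum_consColumn_mul]
  by_cases h0 : Fin.tail b = 0
  · have hbs : b = Pi.single 0 (b 0) := by
      ext i
      refine Fin.cases ?_ (fun i => ?_) i
      · simp
      · simpa [Fin.tail] using congrFun h0 i
    have hN : N1 (fun i => (b i : ℝ)) = |(b 0 : ℝ)| * N1 (Pi.single 0 1) := by
      rw [← hN1.apply_single, ← hb, ← hbs]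
    rw [hN] at hb1 hbt
    have hq : b 0 ≠ 0 := by
      intro h
      rw [h] at hb1
      norm_num at hb1
    refine (hcol (b 0) hq hbt z).trans (le_of_eq ?_)
    congr 1
    ext j
    have hz : ∀ i : Fin (p + 1), b i.succ = 0 := fun i => congrFun h0 i
    simp [hz, mul_comm]
  · exact hrest b h0 hbt z

/-- Matrices `X` in the unit cube for which some integer vector outside the first column gives an
approximation better than `δ` within height `B`. -/
def badMatrices (p : ℕ) (ξ : Fin m → ℝ) (δ : ℝ) (B : ℕ) : Set (Fin m → Fin (p + 1) → ℝ) :=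
  {X | X ∈ Set.Icc 0 1 ∧
      ∃ (b₀ : ℤ) (b : Fin (p + 1) → ℤ), |b₀| ≤ B ∧ (∀ i, |b i| ≤ B) ∧ b ≠ 0 ∧
        ∀ j, ∃ z : ℤ, |ξ j * b₀ + ∑ i, X j i * b i + z| ≤ δ}

lemma le_of_notMem_badMatrices {γ C : ℝ} (hγ : 0 < γ) (hγN : ∀ x j, |x j| * γ ≤ N2 x)
    (hCN : ∀ x, ‖x‖ ≤ C * N1 x) (hC : 0 < C) {ξ : Fin m → ℝ} {X : Fin m → Fin (p + 1) → ℝ}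
    {t r : ℝ} (hX : X ∈ Set.Icc 0 1) (hXb : X ∉ badMatrices p ξ (r / γ) ⌊C * t⌋₊)
    (b : Fin (p + 2) → ℤ) (hb : Fin.tail b ≠ 0) (hbt : N1 (fun i => (b i : ℝ)) ≤ t)
    (z : Fin m → ℤ) : r ≤ N2 (fun j => ξ j * b 0 + ∑ i, X j i * Fin.tail b i + z j) := by
  have hbi : ∀ i, |b i| ≤ (⌊C * t⌋₊ : ℤ) := by
    intro i
    have h1 : ((|b i| : ℤ) : ℝ) ≤ C * t := by
      rw [Int.cast_abs, ← Real.norm_eq_abs]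
      exact (norm_le_pi_norm (fun i => (b i : ℝ)) i).trans ((hCN _).trans (by gcongr))
    have h2 : (|b i|.toNat : ℤ) = |b i| := Int.toNat_of_nonneg (abs_nonneg _)
    rw [← h2] at h1 ⊢
    exact_mod_cast Nat.le_floor (by exact_mod_cast h1)
  have hn : ¬ ∀ j, ∃ z : ℤ, |ξ j * b 0 + ∑ i, X j i * Fin.tail b i + z| ≤ r / γ := fun h =>
    hXb ⟨hX, b 0, Fin.tail b, hbi 0, fun i => hbi _, hb, h⟩
  push Not at hn
  obtain ⟨j, hj⟩ := hn
  have h1 := hj (z j)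
  rw [div_lt_iff₀ hγ] at h1
  exact h1.le.trans (hγN (fun j => ξ j * b 0 + ∑ i, X j i * Fin.tail b i + z j) j)

lemma volume_badMatrices_le_half (hm : m ≠ 0) {α γ C c T : ℝ} (hα : 0 < α) (hγ : 0 < γ)
    (hC : 0 < C) (hc : 0 ≤ c) (hc1 : c ≤ 1) (hT : 1 ≤ T)
    (hcA : (2 * C * α + 1) ^ (p + 2) * (6 / γ) ^ m / α ^ (p + 2) * c ≤ 1 / 2)
    (ξ : Fin m → ℝ) {t : ℝ} (ht : t ≤ α * T) (ht0 : 0 ≤ t) :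
    volume (badMatrices p ξ (c / (α * T) ^ (((p + 2 : ℕ) : ℝ) / m) / γ) ⌊C * t⌋₊) ≤ 2⁻¹ := by
  have hTp : 0 < T := by linarith
  refine (volume_matrix_le ξ _ _).trans ?_
  rw [← ENNReal.ofReal_pow (by positivity), ← ENNReal.ofReal_mul (by positivity)]
  have h2 : (2⁻¹ : ℝ≥0∞) = ENNReal.ofReal (1 / 2) := by
    rw [one_div, ENNReal.ofReal_inv_of_pos two_pos]; simp
  rw [h2]
  refine ENNReal.ofReal_le_ofReal (le_trans ?_ hcA)
  have hB : 2 * (⌊C * t⌋₊ : ℝ) + 1 ≤ (2 * C * α + 1) * T := by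
    have h1 : (⌊C * t⌋₊ : ℝ) ≤ C * t := Nat.floor_le (by positivity)
    have h2 : C * t ≤ C * (α * T) := by gcongr
    nlinarith
  have hpow : ((α * T) ^ (((p + 2 : ℕ) : ℝ) / m)) ^ m = (α * T) ^ (p + 2) := by
    rw [← Real.rpow_natCast, ← Real.rpow_mul (by positivity), div_mul_cancel₀ _ (by simpa using hm),
      Real.rpow_natCast]
  have hcm : c ^ m ≤ c := pow_le_of_le_one hc hc1 hm
  calc (2 * (⌊C * t⌋₊ : ℝ) + 1) ^ (p + 2) *
        (6 * (c / (α * T) ^ (((p + 2 : ℕ) : ℝ) / m) / γ)) ^ m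
      ≤ ((2 * C * α + 1) * T) ^ (p + 2) *
        (6 * (c / (α * T) ^ (((p + 2 : ℕ) : ℝ) / m) / γ)) ^ m := by gcongr
    _ = (2 * C * α + 1) ^ (p + 2) * (6 / γ) ^ m / α ^ (p + 2) * c ^ m := by
        rw [show 6 * (c / (α * T) ^ (((p + 2 : ℕ) : ℝ) / m) / γ) =
          (6 / γ) * c / (α * T) ^ (((p + 2 : ℕ) : ℝ) / m) by ring, div_pow, hpow, mul_pow, mul_pow,
          mul_pow]
        field_simp
    _ ≤ _ := by gcongr

end Column

lemma pow_rpow_mul_div_le {m : ℕ} (hm : 2 ≤ m) {w Q : ℝ} (hQ : 1 ≤ Q) (hw : w ≤ 1 - 1 / m) :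
    (Q ^ (2 * m)) ^ w * (Q / Q ^ (2 * m)) ≤ 1 / Q := by
  have hQ0 : 0 < Q := by linarith
  have hm0 : (0 : ℝ) < m := by positivity
  have h1 : (Q ^ (2 * m)) ^ w ≤ Q ^ (2 * m - 2) := by
    calc (Q ^ (2 * m)) ^ w ≤ (Q ^ (2 * m)) ^ (1 - 1 / (m : ℝ)) :=
          Real.rpow_le_rpow_of_exponent_le (one_le_pow₀ hQ) hw
      _ = Q ^ (2 * m - 2) := by
          rw [← Real.rpow_natCast, ← Real.rpow_mul hQ0.le, ← Real.rpow_natCast Q (2 * m - 2)]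
          congr 1
          rw [Nat.cast_sub (by omega)]
          push_cast
          field_simp
  have h2 : Q ^ (2 * m) = Q ^ (2 * m - 2) * Q ^ 2 := by
    rw [← pow_add]; congr 1; omega
  calc (Q ^ (2 * m)) ^ w * (Q / Q ^ (2 * m)) ≤ Q ^ (2 * m - 2) * (Q / Q ^ (2 * m)) := by gcongr
    _ = 1 / Q := by rw [h2]; field_simp

lemma rpow_mul_one_div_cube_le {w T : ℝ} (hT : 1 ≤ T) (hw : w ≤ 2) :
    T ^ w * (1 / T ^ 3) ≤ 1 / T := by
  have hT0 : 0 < T := by linarith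
  calc T ^ w * (1 / T ^ 3) ≤ T ^ (2 : ℕ) * (1 / T ^ 3) := by
        gcongr
        rw [← Real.rpow_natCast]
        exact Real.rpow_le_rpow_of_exponent_le hT (by push_cast; linarith)
    _ = 1 / T := by field_simp

lemma one_sub_mul_rpow_le {α w T : ℝ} (hα : 0 < α) (hw : w ≤ 1) (hT : 1 ≤ T) :
    (1 - 1 / T) * (α * T) ^ w ≤ (α * (T - 1 / 2)) ^ w := by
  have hT0 : 0 < T := by linarith
  have h2 : α * (T - 1 / 2) = (1 - 1 / (2 * T)) * (α * T) := by field_simp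
  have h4 : 1 / T ≤ 1 := by rw [div_le_one hT0]; exact hT
  have h5 : 0 < 1 / T := by positivity
  have h6 : 1 / T = 1 / (2 * T) + 1 / (2 * T) := by field_simp; norm_num
  have h8 : 0 ≤ 1 - 1 / (2 * T) := by linarith
  rw [h2, Real.mul_rpow (y := α * T) h8 (by positivity)]
  have h7 : 1 - 1 / T ≤ (1 - 1 / (2 * T)) ^ w :=
    le_trans (by linarith) (Real.self_le_rpow_of_le_one (by linarith) (by linarith) hw)
  exact mul_le_mul_of_nonneg_right h7 (by positivity)

lemma sub_div_le_rpow_mul {α e c K D w S T μ κ : ℝ} (hα : 0 < α) (he : 0 < e) (hc : 0 < c)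
    (hK : 0 < K) (hD : 2 * α ^ w * e ≤ D) (hw1 : w ≤ 1) (hκ : 0 < κ) (hκS : κ ≤ S)
    (hκT : κ ≤ T) (hT : 1 ≤ T) (hKS : K * S ≤ μ) (hr : 0 ≤ 1 / μ - 2 / T ^ 3)
    (hcrit : (α * T) ^ w * (e / μ) ≤ c) (hcrit' : c * (1 - 1 / μ) ≤ (α * T) ^ w * (e / μ)) :
    c - (c + c / K + D) / κ ≤ (α * (T - 1 / 2)) ^ w * (e * (1 / μ - 2 / T ^ 3)) := by
  have hT0 : 0 < T := by linarith
  have hD0 : 0 < D := lt_of_lt_of_le (by positivity) hD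
  have hTw := rpow_mul_one_div_cube_le hT (by linarith : w ≤ 2)
  set A : ℝ := (α * T) ^ w * (e * (1 / μ - 2 / T ^ 3)) with hA
  have hAeq : A = (α * T) ^ w * (e / μ) - 2 * α ^ w * e * (T ^ w * (1 / T ^ 3)) := by
    rw [hA, Real.mul_rpow hα.le hT0.le]; ring
  have hAc : A ≤ c := by
    have : 0 ≤ 2 * α ^ w * e * (T ^ w * (1 / T ^ 3)) := by positivity
    linarith
  have hAlow : c - c / μ - D / T ≤ A := by
    have h3 : 2 * α ^ w * e * (T ^ w * (1 / T ^ 3)) ≤ D * (1 / T) := by gcongr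
    have h4 : c * (1 - 1 / μ) = c - c / μ := by ring
    have h5 : D * (1 / T) = D / T := by ring
    linarith
  calc c - (c + c / K + D) / κ
      = c - c / κ - c / (K * κ) - D / κ := by field_simp; ring
    _ ≤ c - c / T - c / μ - D / T := by
        have h2 : c / T ≤ c / κ := by gcongr
        have h3 : c / μ ≤ c / (K * κ) := by
          gcongr
          exact le_trans (by gcongr) hKS
        have h4 : D / T ≤ D / κ := by gcongr
        linarith
    _ ≤ A - A / T := by
        have h2 : A / T ≤ c / T := by gcongr
        linarith
    _ = (1 - 1 / T) * (α * T) ^ w * (e * (1 / μ - 2 / T ^ 3)) := by rw [hA]; ring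
    _ ≤ _ := by
        gcongr
        exact one_sub_mul_rpow_le hα hw1 hT

section PairColumn

variable {m p : ℕ} {N1 : (Fin (p + 2) → ℝ) → ℝ} {N2 : (Fin m → ℝ) → ℝ} {i₀ i₁ : Fin m}
  {α e₀ e₁ w x y : ℝ} {X : Fin m → Fin (p + 1) → ℝ}

lemma rpow_mul_psiGen_pair_le_div (hN1 : IsNorm N1) (hN2 : IsNorm N2)
    (hα : N1 (Pi.single 0 1) = α) (he₀ : N2 (Pi.single i₀ 1) = e₀)
    (he₁ : N2 (Pi.single i₁ 1) = e₁) (hm : 2 ≤ m) (hw0 : 0 ≤ w) (hw : w ≤ 1 - 1 / m) {q : ℕ}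
    (hq : 1 ≤ q) {z₁ z₂ : ℤ} (hz₁ : |q * x + z₁| ≤ 2 * q / (q : ℝ) ^ (2 * m))
    (hz₂ : |q * y + z₂| ≤ 2 * q / (q : ℝ) ^ (2 * m)) {s : ℝ} (hq1 : 1 ≤ α * q)
    (hs : α * q ≤ s) (hs' : s ≤ α * (q : ℝ) ^ (2 * m)) :
    s ^ w * psiGen m (p + 2) N1 N2 (consColumn (Pi.single i₀ x + Pi.single i₁ y) X) s ≤
      2 * α ^ w * (e₀ + e₁) / q := by
  have hα0 : 0 < α := hα ▸ hN1.apply_single_pos 0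
  have he₀0 : 0 < e₀ := he₀ ▸ hN2.apply_single_pos i₀
  have he₁0 : 0 < e₁ := he₁ ▸ hN2.apply_single_pos i₁
  have hqR : (1 : ℝ) ≤ q := by exact_mod_cast hq
  have hq0 : (0 : ℝ) < q := by linarith
  have hs0 : 0 ≤ s := by linarith
  have hqa : |((q : ℤ) : ℝ)| * N1 (Pi.single 0 1) = α * q := by
    rw [hα, Int.cast_natCast, abs_of_pos hq0, mul_comm]
  have hψ := psiGen_pair_le hN1 hN2 (i₀ := i₀) (i₁ := i₁) x y X s q z₁ z₂
    (by rwa [hqa]) (by rwa [hqa])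
  rw [he₀, he₁, Int.cast_natCast] at hψ
  calc _ ≤ (α * (q : ℝ) ^ (2 * m)) ^ w *
        (2 * q / (q : ℝ) ^ (2 * m) * e₀ + 2 * q / (q : ℝ) ^ (2 * m) * e₁) :=
        mul_le_mul (Real.rpow_le_rpow hs0 hs' hw0) (hψ.trans (by gcongr))
          (psiGen_nonneg hN2 _ _) (by positivity)
    _ = 2 * α ^ w * (e₀ + e₁) * (((q : ℝ) ^ (2 * m)) ^ w * (q / (q : ℝ) ^ (2 * m))) := by
        rw [Real.mul_rpow hα0.le (by positivity)]; ring
    _ ≤ 2 * α ^ w * (e₀ + e₁) * (1 / q) := by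
        gcongr
        exact pow_rpow_mul_div_le hm hqR hw
    _ = _ := by ring

lemma rpow_mul_psiGen_pair_le_add (hN1 : IsNorm N1) (hN2 : IsNorm N2)
    (hα : N1 (Pi.single 0 1) = α) (he₀ : N2 (Pi.single i₀ 1) = e₀)
    (he₁ : N2 (Pi.single i₁ 1) = e₁) (hw0 : 0 ≤ w) (hw1 : w ≤ 1) {q : ℕ} {T μ c : ℝ}
    (hq : 1 ≤ q) (hT : 1 ≤ T) {z₁ z₂ : ℤ} (hz₁ : |q * x + z₁| ≤ 1 / μ + 2 / T ^ 3)
    (hz₂ : |q * y + z₂| ≤ 2 / T ^ 3) {s : ℝ} (hq1 : 1 ≤ α * q) (hs : α * q ≤ s)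
    (hs' : s ≤ α * T) (hcrit : (α * T) ^ w * (e₀ / μ) ≤ c) :
    s ^ w * psiGen m (p + 2) N1 N2 (consColumn (Pi.single i₀ x + Pi.single i₁ y) X) s ≤
      c + 2 * α ^ w * (e₀ + e₁) / T := by
  have hα0 : 0 < α := hα ▸ hN1.apply_single_pos 0
  have he₀0 : 0 < e₀ := he₀ ▸ hN2.apply_single_pos i₀
  have he₁0 : 0 < e₁ := he₁ ▸ hN2.apply_single_pos i₁
  have hqR : (1 : ℝ) ≤ q := by exact_mod_cast hq
  have hq0 : (0 : ℝ) < q := by linarith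
  have hs0 : 0 ≤ s := by linarith
  have hT0 : 0 < T := by linarith
  have hqa : |((q : ℤ) : ℝ)| * N1 (Pi.single 0 1) = α * q := by
    rw [hα, Int.cast_natCast, abs_of_pos hq0, mul_comm]
  have hψ := psiGen_pair_le hN1 hN2 (i₀ := i₀) (i₁ := i₁) x y X s q z₁ z₂
    (by rwa [hqa]) (by rwa [hqa])
  rw [he₀, he₁, Int.cast_natCast] at hψ
  calc _ ≤ (α * T) ^ w * ((1 / μ + 2 / T ^ 3) * e₀ + 2 / T ^ 3 * e₁) :=
        mul_le_mul (Real.rpow_le_rpow hs0 hs' hw0) (hψ.trans (by gcongr))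
          (psiGen_nonneg hN2 _ _) (by positivity)
    _ = (α * T) ^ w * (e₀ / μ) + 2 * α ^ w * (e₀ + e₁) * (T ^ w * (1 / T ^ 3)) := by
        rw [Real.mul_rpow hα0.le hT0.le]; ring
    _ ≤ c + 2 * α ^ w * (e₀ + e₁) * (1 / T) := by
        gcongr
        exact rpow_mul_one_div_cube_le hT (by linarith)
    _ = _ := by ring

lemma le_psiGen_pair (hN1 : IsNorm N1) (hN2 : IsNorm N2) (hN2e : IsExpanding N2) (hi : i₀ ≠ i₁)
    (hα : N1 (Pi.single 0 1) = α) (he₀ : N2 (Pi.single i₀ 1) = e₀)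
    (he₁ : N2 (Pi.single i₁ 1) = e₁) {γ C c K S T μ : ℝ} (hγ : 0 < γ)
    (hγN : ∀ x j, |x j| * γ ≤ N2 x) (hC : 0 < C) (hCN : ∀ x, ‖x‖ ≤ C * N1 x)
    (hK : K = 2 * e₀ / e₁) {q : ℕ} (hq : 1 ≤ q) (hqS : 2 * q ≤ S) (hS : 4 ≤ S) (hST : S ≤ T)
    (hKS : K * S ≤ μ) (hq1 : 1 ≤ α * q) (hcrit : (α * T) ^ w * (e₀ / μ) ≤ c)
    (hsep : ∀ q : ℤ, q ≠ 0 → |(q : ℝ)| < T → ∀ z₁ z₂ : ℤ,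
      1 / S - 2 / T ^ 3 ≤ |q * y + z₂| ∨ 1 / μ - 2 / T ^ 3 ≤ |q * x + z₁|)
    (hX : X ∈ Set.Icc 0 1)
    (hXb : X ∉ badMatrices p (Pi.single i₀ x + Pi.single i₁ y) (c / (α * T) ^ w / γ)
      ⌊C * (α * (T - 1 / 2))⌋₊) :
    e₀ * (1 / μ - 2 / T ^ 3) ≤
      psiGen m (p + 2) N1 N2 (consColumn (Pi.single i₀ x + Pi.single i₁ y) X)
        (α * (T - 1 / 2)) := by
  have hα0 : 0 < α := hα ▸ hN1.apply_single_pos 0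
  have he₀0 : 0 < e₀ := he₀ ▸ hN2.apply_single_pos i₀
  have he₁0 : 0 < e₁ := he₁ ▸ hN2.apply_single_pos i₁
  have hqR : (1 : ℝ) ≤ q := by exact_mod_cast hq
  have hq0 : (0 : ℝ) < q := by linarith
  have hS0 : 0 < S := by linarith
  have hT0 : 0 < T := by linarith
  have hK0 : 0 < K := by rw [hK]; positivity
  have hTS4 : 2 / T ^ 3 ≤ 1 / (2 * S) := by
    rw [div_le_div_iff₀ (by positivity) (by positivity)]
    have : 4 * T ≤ T ^ 3 := by nlinarith [sq_nonneg (T - 4)]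
    linarith
  have hrμ : e₀ * (1 / μ - 2 / T ^ 3) ≤ e₀ / μ := by
    rw [mul_sub, mul_one_div]
    have : 0 < e₀ * (2 / T ^ 3) := by positivity
    linarith
  have hqa : |((q : ℤ) : ℝ)| * N1 (Pi.single 0 1) = α * q := by
    rw [hα, Int.cast_natCast, abs_of_pos hq0, mul_comm]
  refine le_psiGen_consColumn hN1 (q : ℤ) (by rwa [hqa]) ?_ ?_ ?_
  · rw [hqa]
    gcongr
    linarith
  · intro q hq hqt z
    rw [hα, mul_comm] at hqt
    have hqT : |(q : ℝ)| < T := by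
      have h2 := le_of_mul_le_mul_left hqt hα0
      linarith
    set ξ : Fin m → ℝ := Pi.single i₀ x + Pi.single i₁ y with hξ
    have hv₀ := hN2.mul_le_of_isExpanding hN2e (fun j => q * ξ j + z j) i₀
    have hv₁ := hN2.mul_le_of_isExpanding hN2e (fun j => q * ξ j + z j) i₁
    have hξ₀ : ξ i₀ = x := by simp [hξ, hi]
    have hξ₁ : ξ i₁ = y := by simp [hξ, hi.symm]
    simp only [hξ₀, hξ₁, he₀, he₁] at hv₀ hv₁
    rcases hsep q hq hqT (z i₀) (z i₁) with h | h
    · refine le_trans ?_ hv₁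
      calc e₀ * (1 / μ - 2 / T ^ 3) ≤ e₀ / μ := hrμ
        _ ≤ e₀ / (K * S) := by gcongr
        _ = 1 / (2 * S) * e₁ := by rw [hK]; field_simp
        _ ≤ (1 / S - 2 / T ^ 3) * e₁ := by
          gcongr
          have : 1 / S = 1 / (2 * S) + 1 / (2 * S) := by field_simp; norm_num
          linarith
        _ ≤ _ := by gcongr
    · refine le_trans ?_ hv₀
      rw [mul_comm]
      gcongr
  · intro b hb hbt z
    refine le_trans (hrμ.trans ?_) (le_of_notMem_badMatrices hγ hγN hCN hC hX hXb b hb hbt z)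
    rw [le_div_iff₀ (by positivity), mul_comm]
    exact hcrit

lemma sub_div_le_rpow_mul_psiGen_pair (hN1 : IsNorm N1) (hN2 : IsNorm N2)
    (hN2e : IsExpanding N2) (hi : i₀ ≠ i₁) (hα : N1 (Pi.single 0 1) = α)
    (he₀ : N2 (Pi.single i₀ 1) = e₀) (he₁ : N2 (Pi.single i₁ 1) = e₁) (hw1 : w ≤ 1)
    {γ C c K S T μ κ : ℝ} (hγ : 0 < γ) (hγN : ∀ x j, |x j| * γ ≤ N2 x) (hC : 0 < C)
    (hCN : ∀ x, ‖x‖ ≤ C * N1 x) (hK : K = 2 * e₀ / e₁) (hc : 0 < c) {q : ℕ} (hq : 1 ≤ q)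
    (hqS : 2 * q ≤ S) (hS : 4 ≤ S) (hTS : T = S * μ) (hμ : 1 ≤ μ) (hKS : K * S ≤ μ)
    (hκ : 0 < κ) (hκS : κ ≤ S) (hq1 : 1 ≤ α * q) (hcrit : (α * T) ^ w * (e₀ / μ) ≤ c)
    (hcrit' : c * (1 - 1 / μ) ≤ (α * T) ^ w * (e₀ / μ))
    (hsep : ∀ q : ℤ, q ≠ 0 → |(q : ℝ)| < T → ∀ z₁ z₂ : ℤ,
      1 / S - 2 / T ^ 3 ≤ |q * y + z₂| ∨ 1 / μ - 2 / T ^ 3 ≤ |q * x + z₁|)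
    (hX : X ∈ Set.Icc 0 1)
    (hXb : X ∉ badMatrices p (Pi.single i₀ x + Pi.single i₁ y) (c / (α * T) ^ w / γ)
      ⌊C * (α * (T - 1 / 2))⌋₊) :
    c - (c + c / K + 2 * α ^ w * (e₀ + e₁)) / κ ≤ (α * (T - 1 / 2)) ^ w *
      psiGen m (p + 2) N1 N2 (consColumn (Pi.single i₀ x + Pi.single i₁ y) X)
        (α * (T - 1 / 2)) := by
  have hα0 : 0 < α := hα ▸ hN1.apply_single_pos 0
  have he₀0 : 0 < e₀ := he₀ ▸ hN2.apply_single_pos i₀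
  have he₁0 : 0 < e₁ := he₁ ▸ hN2.apply_single_pos i₁
  have hK0 : 0 < K := by rw [hK]; positivity
  have hST : S ≤ T := by rw [hTS]; nlinarith
  have hμT : μ ≤ T := by rw [hTS]; nlinarith
  have hT0 : 0 < T := by linarith
  have hTμ : 2 / T ^ 3 ≤ 1 / μ := by
    rw [div_le_div_iff₀ (by positivity) (by positivity)]
    have : 4 * T ≤ T ^ 3 := by nlinarith [sq_nonneg (T - 4)]
    linarith
  refine (sub_div_le_rpow_mul (e := e₀) hα0 he₀0 hc hK0 ?_ hw1 hκ hκS (hκS.trans hST)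
    (by linarith) hKS (by linarith) hcrit hcrit').trans (mul_le_mul_of_nonneg_left
      (le_psiGen_pair hN1 hN2 hN2e hi hα he₀ he₁ hγ hγN hC hCN hK hq hqS hS hST hKS hq1 hcrit hsep
        hX hXb) (Real.rpow_nonneg (mul_nonneg hα0.le (by linarith)) _))
  gcongr
  linarith

end PairColumn

lemma mem_FSsetC_of_scales {m n : ℕ} {N1 : (Fin n → ℝ) → ℝ} {N2 : (Fin m → ℝ) → ℝ}
    (hN2 : IsNorm N2) {Ω : Fin m → Fin n → ℝ} {Q R t : ℕ → ℝ} {α c D E : ℝ} (hα : 0 < α)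
    (hc : 0 ≤ c) (hQ : Tendsto Q atTop atTop) (hQR : ∀ k, Q k ≤ R k) (ht : Tendsto t atTop atTop)
    (hup1 : ∀ k s, 1 ≤ α * Q k → α * Q k ≤ s → s ≤ α * R k →
      s ^ ((n : ℝ) / m) * psiGen m n N1 N2 Ω s ≤ D / Q k)
    (hup2 : ∀ k s, 1 ≤ α * Q k → α * R k ≤ s → s ≤ α * Q (k + 1) →
      s ^ ((n : ℝ) / m) * psiGen m n N1 N2 Ω s ≤ c + D / Q k)
    (hlow : ∃ᶠ k : ℕ in atTop, 1 ≤ α * Q k →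
      c - E / (k + 1) ≤ t k ^ ((n : ℝ) / m) * psiGen m n N1 N2 Ω (t k)) :
    Ω ∈ FSsetC m n N1 N2 c := by
  have hαQ : Tendsto (fun k => α * Q k) atTop atTop := hQ.const_mul_atTop hα
  have hDQ : Tendsto (fun k => D / Q k) atTop (nhds 0) := hQ.const_div_atTop D
  refine mem_FSsetC_of_bounds hN2 ?_ ?_ ?_
  · intro δ hδ
    obtain ⟨k₀, hk₀⟩ := eventually_atTop.1
      ((hαQ.eventually_ge_atTop 1).and (hDQ.eventually (eventually_le_nhds hδ)))
    filter_upwards [eventually_ge_atTop (α * Q k₀)] with s hs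
    obtain ⟨k, hk, hk1, hk2⟩ : ∃ k ≥ k₀, α * Q k ≤ s ∧ s ≤ α * Q (k + 1) := by
      by_contra! hcon
      have hall : ∀ k ≥ k₀, α * Q k ≤ s := by
        intro k hk
        induction k, hk using Nat.le_induction with
        | base => exact hs
        | succ k hk ih => exact (hcon k hk ih).le
      obtain ⟨k, hk⟩ := ((hαQ.eventually_gt_atTop s).and (eventually_ge_atTop k₀)).exists
      exact absurd (hall k hk.2) (not_le.2 hk.1)
    obtain ⟨h1, h2⟩ := hk₀ k hk
    rcases le_total s (α * R k) with h | h
    · have h3 := hup1 k s h1 hk1 h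
      linarith
    · have h3 := hup2 k s h1 h hk2
      linarith
  · intro δ hδ
    have hlim : Tendsto (fun k : ℕ => E / ((k : ℝ) + 1)) atTop (nhds 0) :=
      (tendsto_atTop_add_const_right _ _ tendsto_natCast_atTop_atTop).const_div_atTop _
    refine ht.frequently ((hlow.and_eventually ((hαQ.eventually_ge_atTop 1).and
      (hlim.eventually (eventually_le_nhds hδ)))).mono ?_)
    rintro k ⟨h1, h2, h3⟩
    have h4 := h1 h2
    linarith
  · intro δ hδ
    refine hαQ.frequently (Eventually.frequently ?_)
    filter_upwards [hαQ.eventually_ge_atTop 1, hDQ.eventually (eventually_le_nhds hδ)] with k h1 h2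
    exact (hup1 k _ h1 le_rfl (by gcongr; exact hQR k)).trans h2

lemma exists_column_of_pos {m p : ℕ} (hnm : p + 2 < m) (hmn : m ≤ 2 * (p + 2))
    {N1 : (Fin (p + 2) → ℝ) → ℝ} {N2 : (Fin m → ℝ) → ℝ} (hN1 : IsNorm N1) (hN2 : IsNorm N2)
    (hN2e : IsExpanding N2) {i₀ i₁ : Fin m} (hi : i₀ ≠ i₁) {α e₀ e₁ γ C c K : ℝ}
    (hα : N1 (Pi.single 0 1) = α) (he₀ : N2 (Pi.single i₀ 1) = e₀)
    (he₁ : N2 (Pi.single i₁ 1) = e₁) (hγ : 0 < γ) (hγN : ∀ x j, |x j| * γ ≤ N2 x)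
    (hC : 0 < C) (hCN : ∀ x, ‖x‖ ≤ C * N1 x) (hK : K = 2 * e₀ / e₁) (hc : 0 < c) (hc1 : c ≤ 1)
    (hcK : c < e₀ * α ^ (((p + 2 : ℕ) : ℝ) / m) / K ^ (((p + 2 : ℕ) : ℝ) / m))
    (hcA : (2 * C * α + 1) ^ (p + 2) * (6 / γ) ^ m / α ^ (p + 2) * c ≤ 1 / 2) :
    ∃ ξ : Fin m → ℝ, volume {X | consColumn ξ X ∈ FSsetC m (p + 2) N1 N2 c} ≠ 0 := by
  set w : ℝ := ((p + 2 : ℕ) : ℝ) / m with hw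
  have hm : 2 ≤ m := by omega
  have hmR : (0 : ℝ) < m := by positivity
  have hα0 : 0 < α := hα ▸ hN1.apply_single_pos 0
  have he₀0 : 0 < e₀ := he₀ ▸ hN2.apply_single_pos i₀
  have he₁0 : 0 < e₁ := he₁ ▸ hN2.apply_single_pos i₁
  have hK0 : 0 < K := by rw [hK]; positivity
  have hw2 : 1 / 2 ≤ w := by
    rw [hw, div_le_div_iff₀ two_pos hmR, one_mul, mul_comm]
    exact_mod_cast hmn
  have hwm : w ≤ 1 - 1 / m := by
    rw [hw, div_le_iff₀ hmR, sub_mul, one_mul, div_mul_cancel₀ _ hmR.ne', le_sub_iff_add_le]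
    exact_mod_cast hnm
  have hw1 : w < 1 := by
    have : 0 < 1 / (m : ℝ) := by positivity
    linarith
  have hw0 : 0 < w := by linarith
  have hex : ∀ s : ℕ, ∃ M : ℕ, 1 ≤ M ∧ (1 ≤ s →
      e₀ * α ^ w * ((s : ℝ) * M) ^ w ≤ c * M ∧ c * (M - 1) ≤ e₀ * α ^ w * ((s : ℝ) * M) ^ w ∧
        K * s ≤ M) := by
    intro s
    rcases Nat.eq_zero_or_pos s with h | h
    · exact ⟨1, le_rfl, fun h' => by omega⟩
    · obtain ⟨M, h1, h2⟩ := exists_critical_multiplier hw2 hw1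
        (show 0 < e₀ * α ^ w by positivity) hc hK0 hcK h
      exact ⟨M, h1, fun _ => h2⟩
  choose M hM1 hM using hex
  obtain ⟨x, y, hxy⟩ := exists_column_approx hm hM1
  have hQ2 := two_le_denomSeq hm hM1
  have hQlt := lt_denomSeq hm hM1
  have hQS' := two_mul_denomSeq_le_pow hm hM1
  have hTS' : ∀ k, denomSeq m M (k + 1) =
    denomSeq m M k ^ (2 * m) * M (denomSeq m M k ^ (2 * m)) := fun k => rfl
  set Q := denomSeq m M with hQ
  set ξ : Fin m → ℝ := Pi.single i₀ x + Pi.single i₁ y with hξ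
  set t : ℕ → ℝ := fun k => α * (Q (k + 1) - 1 / 2) with ht
  set Bad : ℕ → Set (Fin m → Fin (p + 1) → ℝ) := fun k =>
    badMatrices p ξ (c / (α * Q (k + 1)) ^ w / γ) ⌊C * t k⌋₊ with hBad
  have hQR : ∀ k, (2 : ℝ) ≤ Q k := fun k => by exact_mod_cast hQ2 k
  have hkQ : ∀ k : ℕ, (k : ℝ) < Q k := fun k => by exact_mod_cast hQlt k
  have hvol : ∀ k ≥ 0, volume (Bad k) ≤ 2⁻¹ := fun k _ => by
    have h := hQR (k + 1)
    refine volume_badMatrices_le_half (by omega) hα0 hγ hC hc.le hc1 (by linarith) hcA ξ ?_ ?_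
    · simp only [ht]; gcongr; linarith
    · simp only [ht]; exact mul_nonneg hα0.le (by linarith)
  have hcube : volume (Set.Icc (0 : Fin m → Fin (p + 1) → ℝ) 1) = 1 := by
    rw [← Set.pi_univ_Icc, volume_pi_pi]
    simp [Real.volume_Icc_pi]
  refine ⟨ξ, fun h0 => exists_volume_frequently_ne_zero volume _ hcube Bad 0 hvol
    (measure_mono_null ?_ h0)⟩
  rintro X ⟨hXc, hXf⟩
  have hstep : ∀ k, ∃ S T μ : ℝ, S = (Q k : ℝ) ^ (2 * m) ∧ T = Q (k + 1) ∧
      μ = M (Q k ^ (2 * m)) ∧ T = S * μ ∧ 1 ≤ μ ∧ 4 ≤ S ∧ Q k ≤ S ∧ (k : ℝ) < S ∧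
      (α * T) ^ w * (e₀ / μ) ≤ c ∧ c * (1 - 1 / μ) ≤ (α * T) ^ w * (e₀ / μ) ∧ K * S ≤ μ := by
    intro k
    obtain ⟨h1, h2, h3⟩ := hM (Q k ^ (2 * m)) (Nat.pow_pos (by have := hQ2 k; omega))
    have hμ : (1 : ℝ) ≤ M (Q k ^ (2 * m)) := by exact_mod_cast hM1 _
    have hμ0 : (0 : ℝ) < M (Q k ^ (2 * m)) := by linarith
    have hT : (Q (k + 1) : ℝ) = (Q k : ℝ) ^ (2 * m) * M (Q k ^ (2 * m)) := by
      exact_mod_cast hTS' k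
    have hQS : 2 * (Q k : ℝ) ≤ (Q k : ℝ) ^ (2 * m) := by exact_mod_cast hQS' k
    have hQk := hQR k
    have hkk := hkQ k
    push_cast at h1 h2 h3
    rw [← hT] at h1 h2
    have hαT : (α * Q (k + 1)) ^ w = α ^ w * (Q (k + 1) : ℝ) ^ w :=
      Real.mul_rpow hα0.le (by positivity)
    refine ⟨_, _, _, rfl, rfl, rfl, hT, hμ, by linarith, by linarith, by linarith, ?_, ?_, h3⟩
    · rw [← mul_div_assoc, div_le_iff₀ hμ0, hαT]
      linarith
    · rw [← mul_div_assoc, le_div_iff₀ hμ0, hαT, mul_assoc, sub_mul, one_mul,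
        div_mul_cancel₀ _ hμ0.ne']
      linarith
  change consColumn ξ X ∈ FSsetC m (p + 2) N1 N2 c
  have hQtop : Tendsto (fun k => (Q k : ℝ)) atTop atTop :=
    tendsto_atTop_mono (fun k => (hkQ k).le) tendsto_natCast_atTop_atTop
  have htt : Tendsto t atTop atTop := Tendsto.const_mul_atTop hα0
    (tendsto_atTop_add_const_right _ (-(1 / 2)) ((tendsto_add_atTop_iff_nat 1).2 hQtop))
  refine mem_FSsetC_of_scales hN2 (R := fun k => (Q k : ℝ) ^ (2 * m))
    (D := 2 * α ^ w * (e₀ + e₁)) (E := c + c / K + 2 * α ^ w * (e₀ + e₁)) hα0 hc.le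
    hQtop (fun k => le_self_pow₀ (by linarith [hQR k]) (by omega)) htt ?_ ?_ (hXf.mono ?_)
  · intro k s h1 hs1 hs2
    obtain ⟨⟨z₁, z₂, hz₁, hz₂⟩, -, -⟩ := hxy k
    exact rpow_mul_psiGen_pair_le_div hN1 hN2 hα he₀ he₁ hm hw0.le hwm
      (by have := hQ2 k; omega) hz₁ hz₂ h1 hs1 hs2
  · intro k s h1 hs1 hs2
    obtain ⟨S, T, μ, hS, hT, hμ, hTS, hμ1, hS4, hQS, hkS, hcrit, -, -⟩ := hstep k
    obtain ⟨-, ⟨z₁, z₂, hz₁, hz₂⟩, -⟩ := hxy k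
    have hQk := hQR k
    have hQT : (Q k : ℝ) ≤ T := by rw [hTS]; nlinarith
    have hcast : ((Q k ^ (2 * m) : ℕ) : ℝ) = (Q k : ℝ) ^ (2 * m) := by push_cast; rfl
    rw [← hT] at hs2 hz₁ hz₂
    rw [← hμ] at hz₁
    rw [← hcast] at hs1 hz₁ hz₂
    refine (rpow_mul_psiGen_pair_le_add hN1 hN2 hα he₀ he₁ hw0.le hw1.le
      (Nat.one_le_pow _ _ (by have := hQ2 k; omega)) (by linarith) hz₁ hz₂ ?_ hs1 hs2
      hcrit).trans ?_
    · refine h1.trans ?_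
      rw [hcast, ← hS]
      gcongr
    · gcongr
  · intro k hXk h1
    obtain ⟨S, T, μ, hS, hT, hμ, hTS, hμ1, hS4, hQS, hkS, hcrit, hcrit', hKS⟩ := hstep k
    obtain ⟨-, -, hsep⟩ := hxy k
    rw [← hS, ← hT, ← hμ] at hsep
    simp only [hBad, ht, ← hT] at hXk
    simp only [ht, ← hT]
    have hkS1 : (k : ℝ) + 1 ≤ S := by
      rw [hS]
      have h2 := hQlt k
      have h3 := hQS' k
      exact_mod_cast (show k + 1 ≤ Q k ^ (2 * m) by omega)
    refine sub_div_le_rpow_mul_psiGen_pair hN1 hN2 hN2e hi hα he₀ he₁ hw1.le hγ hγN hC hCN hK hc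
      (by have := hQ2 k; omega) (by rw [hS]; exact_mod_cast hQS' k) hS4 hTS hμ1 hKS
      (by positivity) hkS1 h1 hcrit hcrit' ?_ hXc hXk
    intro q hq hqT
    refine hsep q hq ?_
    have h3 : ((|q| : ℤ) : ℝ) < ((Q (k + 1) : ℤ) : ℝ) := by
      rw [Int.cast_abs, Int.cast_natCast, ← hT]; exact hqT
    exact_mod_cast h3

lemma exists_column_zero {m p : ℕ} {N1 : (Fin (p + 2) → ℝ) → ℝ} {N2 : (Fin m → ℝ) → ℝ}
    (hN1 : IsNorm N1) (hN2 : IsNorm N2) :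
    ∃ ξ : Fin m → ℝ, volume {X | consColumn ξ X ∈ FSsetC m (p + 2) N1 N2 0} ≠ 0 := by
  refine ⟨0, ?_⟩
  have huniv : {X : Fin m → Fin (p + 1) → ℝ | consColumn 0 X ∈ FSsetC m (p + 2) N1 N2 0} =
      Set.univ := by
    refine Set.eq_univ_of_forall fun X => ?_
    have hα := hN1.apply_single_pos 0
    obtain ⟨q, hq⟩ := exists_nat_gt (1 / N1 (Pi.single 0 1))
    rw [div_lt_iff₀ hα] at hq
    have hzero : ∀ᶠ t : ℝ in atTop,
        t ^ (((p + 2 : ℕ) : ℝ) / (m : ℝ)) * psiGen m (p + 2) N1 N2 (consColumn 0 X) t = 0 := by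
      filter_upwards [eventually_ge_atTop ((q : ℝ) * N1 (Pi.single 0 1))] with t ht
      have h := psiGen_consColumn_le hN1 hN2 0 X t q 0 (by simpa using hq.le) (by simpa using ht)
      have h2 : (fun j : Fin m => (((q : ℤ) : ℝ)) * (0 : Fin m → ℝ) j +
          (((0 : Fin m → ℤ) j : ℤ) : ℝ)) = 0 := by
        ext j; simp
      rw [h2, hN2.apply_zero] at h
      rw [le_antisymm h (psiGen_nonneg hN2 _ _), mul_zero]
    rw [Set.mem_ofPred_eq]
    refine mem_FSsetC_of_bounds hN2 (fun δ hδ => ?_) (fun δ hδ => ?_) (fun δ hδ => ?_)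
    · filter_upwards [hzero] with t ht
      rw [ht]; linarith
    · refine (hzero.mono fun t ht => ?_).frequently
      rw [ht]; linarith
    · refine (hzero.mono fun t ht => ?_).frequently
      rw [ht]; linarith
  rw [huniv]
  exact isOpen_univ.measure_ne_zero volume Set.univ_nonempty

lemma exists_column {m p : ℕ} (hnm : p + 2 < m) (hmn : m ≤ 2 * (p + 2))
    {N1 : (Fin (p + 2) → ℝ) → ℝ} {N2 : (Fin m → ℝ) → ℝ} (hN1 : IsNorm N1) (hN2 : IsNorm N2)
    (hN2e : IsExpanding N2) :
    ∃ c₀ : ℝ, 0 < c₀ ∧ ∀ c, 0 ≤ c → c ≤ c₀ →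
      ∃ ξ : Fin m → ℝ, volume {X | consColumn ξ X ∈ FSsetC m (p + 2) N1 N2 c} ≠ 0 := by
  obtain ⟨C, hC, hCN⟩ := hN1.exists_norm_le
  obtain ⟨G, hG, hGN⟩ := hN2.exists_norm_le
  have hγN : ∀ x j, |x j| * G⁻¹ ≤ N2 x := fun x j => by
    rw [← div_eq_mul_inv, div_le_iff₀ hG, mul_comm]
    exact (norm_le_pi_norm x j).trans (hGN x)
  set i₀ : Fin m := ⟨0, by omega⟩
  set i₁ : Fin m := ⟨1, by omega⟩
  have hi : i₀ ≠ i₁ := by simp [i₀, i₁]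
  have hα := hN1.apply_single_pos 0
  have he₀ := hN2.apply_single_pos i₀
  have he₁ := hN2.apply_single_pos i₁
  set α := N1 (Pi.single 0 1) with hαd
  set e₀ := N2 (Pi.single i₀ 1) with he₀d
  set e₁ := N2 (Pi.single i₁ 1) with he₁d
  set L : ℝ := e₀ * α ^ (((p + 2 : ℕ) : ℝ) / m) / (2 * e₀ / e₁) ^ (((p + 2 : ℕ) : ℝ) / m) with hL
  set A : ℝ := (2 * C * α + 1) ^ (p + 2) * (6 / G⁻¹) ^ m / α ^ (p + 2) with hA
  have hL0 : 0 < L := by positivity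
  have hA0 : 0 < A := by positivity
  refine ⟨min 1 (min (L / 2) (1 / (2 * A))), by positivity, fun c hc0 hc => ?_⟩
  rcases hc0.eq_or_lt with rfl | hcp
  · exact exists_column_zero hN1 hN2
  simp only [le_min_iff] at hc
  obtain ⟨hc1, hc2, hc3⟩ := hc
  refine exists_column_of_pos hnm hmn hN1 hN2 hN2e hi hαd.symm he₀d.symm he₁d.symm
    (inv_pos.2 hG) hγN hC hCN rfl hcp hc1 (by linarith) ?_
  calc A * c ≤ A * (1 / (2 * A)) := by gcongr
    _ = 1 / 2 := by field_simp

lemma natCast_le_dimH_FSsetC {m p : ℕ} {N1 : (Fin (p + 2) → ℝ) → ℝ} {N2 : (Fin m → ℝ) → ℝ}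
    {c : ℝ} {ξ : Fin m → ℝ}
    (hξ : volume {X | consColumn ξ X ∈ FSsetC m (p + 2) N1 N2 c} ≠ 0) :
    ((m * (p + 1) : ℕ) : ℝ≥0∞) ≤ dimH (FSsetC m (p + 2) N1 N2 c) := by
  set f : (Fin m → Fin (p + 2) → ℝ) → Fin m → Fin (p + 1) → ℝ := fun Ω j => Fin.tail (Ω j)
  have hf : LipschitzWith 1 f := by
    refine LipschitzWith.of_dist_le_mul fun Ω Ω' => ?_
    rw [NNReal.coe_one, one_mul]
    refine (dist_pi_le_iff dist_nonneg).2 fun j => (dist_pi_le_iff dist_nonneg).2 fun i => ?_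
    exact (dist_le_pi_dist (Ω j) (Ω' j) i.succ).trans (dist_le_pi_dist Ω Ω' j)
  refine (natCast_le_dimH_of_volume_ne_zero hξ).trans
    ((dimH_mono fun X hX => ?_).trans (hf.dimH_image_le _))
  exact ⟨consColumn ξ X, hX, by ext j i; simp [f, consColumn]⟩

/-- for `n ≥ 2`, `m ≥ 4`, `1 < m/n ≤ 2` with `m − n ≠ 2` unless `n = 2`,
any norm `‖·‖₁`, any expanding norm `‖·‖₂` (both expanding if `(m,n) = (4,2)`),
there is `c_{m,n} > 0` so that for all `c ∈ [0,c_{m,n}]` the set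
`FS_{m,n}(‖·‖₁,‖·‖₂,c)` is non-empty, has the stated Hausdorff dimension lower
bounds, contains matrices of full rank `n`, and the Dirichlet spectrum contains a
right neighborhood of `0`. -/
theorem FSsetC_nonempty_closeRatio (m n : ℕ) (hn : 2 ≤ n) (hm : 4 ≤ m)
    (hratio1 : n < m) (hratio2 : m ≤ 2 * n)
    (hdiff : n ≠ 2 → m ≠ n + 2)
    (N1 : (Fin n → ℝ) → ℝ) (N2 : (Fin m → ℝ) → ℝ)
    (hN1 : IsNorm N1) (hN2 : IsNorm N2) (hN2e : IsExpanding N2)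
    (hN1e : m = 4 ∧ n = 2 → IsExpanding N1) :
    ∃ cmn : ℝ, 0 < cmn ∧
      (∀ c : ℝ, 0 ≤ c → c ≤ cmn →
        (FSsetC m n N1 N2 c).Nonempty ∧
        (5 ≤ m → ((m * (n - 2) + m - 2 : ℕ) : ℝ≥0∞) ≤ dimH (FSsetC m n N1 N2 c)) ∧
        (m = 4 → ((m * (n - 2) : ℕ) : ℝ≥0∞) ≤ dimH (FSsetC m n N1 N2 c)) ∧
        ∃ Ω ∈ FSsetC m n N1 N2 c, (Matrix.of Ω).rank = n) ∧
      Set.Icc (0 : ℝ) cmn ⊆ {y : ℝ | ∃ Ω : Fin m → Fin n → ℝ, ThetaGen m n N1 N2 Ω = y} := by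
  obtain ⟨p, rfl⟩ : ∃ p, n = p + 2 := ⟨n - 2, by omega⟩
  obtain ⟨c₀, hc₀, hcol⟩ := exists_column hratio1 hratio2 hN1 hN2 hN2e
  have hmem : ∀ c : ℝ, 0 ≤ c → c ≤ c₀ → (FSsetC m (p + 2) N1 N2 c).Nonempty := by
    intro c h0 h1
    obtain ⟨ξ, hξ⟩ := hcol c h0 h1
    obtain ⟨X, hX⟩ := nonempty_of_measure_ne_zero hξ
    exact ⟨_, hX⟩
  refine ⟨c₀, hc₀, fun c h0 h1 => ?_, fun c hc => ?_⟩
  · obtain ⟨ξ, hξ⟩ := hcol c h0 h1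
    have hdim := natCast_le_dimH_FSsetC hξ
    have hexp : m * (p + 1) = m * p + m := by ring
    refine ⟨hmem c h0 h1, fun _ => le_trans ?_ hdim, fun _ => le_trans ?_ hdim, ?_⟩
    · rw [hexp, Nat.add_sub_cancel]
      exact_mod_cast Nat.sub_le _ _
    · rw [hexp, Nat.add_sub_cancel]
      exact_mod_cast Nat.le_add_right _ _
    · obtain ⟨Ω, hΩ⟩ := hmem c h0 h1
      exact exists_mem_FSsetC_rank_eq hratio1.le hΩ
  · obtain ⟨Ω, hΩ⟩ := hmem c hc.1 hc.2
    exact ⟨Ω, hΩ.1⟩
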